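/- arXiv:2205.08691 — 2 statements merged into one kernel-verified Lean document; each statement's English description precedes it below -/
import Mathlib

section
/- Let w be a right-special word having 1 B_n as a suffix. Then w is a suffix of (B_n 1)^{2 gamma_n} B_n, or w is a suffix of B_{n+1}, or w has B_{n+1} as a proper suffix. -/
/-- The word sequence `B 1 = 0`, `B (n+1) = ((B n 1)^{γ n} B n)^{L n}` over the alphabet
`{0,1}` (encoded as `Bool` with `false = 0`, `true = 1`). The value at `0` is an
irrelevant placeholder. -/
def Cseq (L γ : ℕ → ℕ) : ℕ → List Bool
  | 0 => [false]
  | 1 => [false]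
  | n + 2 =>
      (List.replicate (L (n + 1))
        ((List.replicate (γ (n + 1)) (Cseq L γ (n + 1) ++ [true])).flatten ++
          Cseq L γ (n + 1))).flatten

/-- The language: all factors of some `B n`. -/
def InLangC (L γ : ℕ → ℕ) (w : List Bool) : Prop :=
  ∃ n, w <:+: Cseq L γ n

/-- The word complexity: the number of words of length `q` in the language. -/
noncomputable def complexityC (L γ : ℕ → ℕ) (q : ℕ) : ℕ :=
  Set.ncard {w : List Bool | w.length = q ∧ InLangC L γ w}

/-- A word `w` is right-special if both `w0` and `w1` belong to the language. -/
def RightSpecialC (L γ : ℕ → ℕ) (w : List Bool) : Prop :=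
  InLangC L γ (w ++ [false]) ∧ InLangC L γ (w ++ [true])

/-- Every letter `x` of `s` is turned into the spacer `1` (if `x` is `true`) or the empty spacer,
followed by a copy of `b`. -/
def spacedTail (b s : List Bool) : List Bool :=
  s.flatMap fun x => if x then true :: b else b

/-- Copies of `b` separated by the spacers listed in `s`. -/
def spaced (b s : List Bool) : List Bool := b ++ spacedTail b s

/-- Copies of `c`, each preceded by a letter of `s`. -/
def interTail (c s : List Bool) : List Bool := s.flatMap fun x => x :: c

/-- Copies of `c` separated by the letters of `s`. -/
def inter (c s : List Bool) : List Bool := c ++ interTail c s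

/-- The spacers between the copies of `B n` in `B (n+1)`, where `g = γ n` and `m + 1 = L n`. -/
def spacers (g m : ℕ) : List Bool :=
  inter (List.replicate g true) (List.replicate m false)

@[simp] lemma spacedTail_nil (b : List Bool) : spacedTail b [] = [] := rfl

@[simp] lemma spacedTail_true (b s : List Bool) :
    spacedTail b (true :: s) = true :: spaced b s := by
  simp [spacedTail, spaced]

@[simp] lemma spacedTail_false (b s : List Bool) :
    spacedTail b (false :: s) = spaced b s := by
  simp [spacedTail, spaced]

lemma spacedTail_append (b s t : List Bool) :
    spacedTail b (s ++ t) = spacedTail b s ++ spacedTail b t := by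
  simp [spacedTail]

lemma spaced_append (b s t : List Bool) :
    spaced b (s ++ t) = spaced b s ++ spacedTail b t := by
  simp [spaced, spacedTail_append]

@[simp] lemma interTail_cons (c s : List Bool) (x : Bool) :
    interTail c (x :: s) = x :: inter c s := by
  simp [interTail, inter]

lemma inter_nil (c : List Bool) : inter c [] = c := by simp [inter, interTail]

lemma inter_cons (c s : List Bool) (x : Bool) :
    inter c (x :: s) = c ++ x :: inter c s := by
  simp [inter]

lemma spaced_inter (b c s : List Bool) : spaced b (inter c s) = spaced (spaced b c) s := by
  induction s with
  | nil => simp [inter_nil, spaced]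
  | cons x s ih =>
    rw [inter_cons, spaced_append]
    cases x
    · rw [spacedTail_false, ih]
      simp [spaced]
    · rw [spacedTail_true, ih]
      simp [spaced]

lemma spaced_replicate_true (b : List Bool) (g : ℕ) :
    spaced b (List.replicate g true) = (List.replicate g (b ++ [true])).flatten ++ b := by
  induction g with
  | zero => simp [spaced]
  | succ g ih =>
    rw [List.replicate_succ, List.replicate_succ, spaced, spacedTail_true, ih]
    simp

lemma spaced_replicate_false (b : List Bool) (m : ℕ) :
    spaced b (List.replicate m false) = (List.replicate (m + 1) b).flatten := by
  induction m with
  | zero => simp [spaced]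
  | succ m ih =>
    rw [List.replicate_succ, List.replicate_succ, spaced, spacedTail_false, ih]
    simp

lemma Cseq_succ (L γ : ℕ → ℕ) (n : ℕ) (hn : 1 ≤ n) (hL : 1 ≤ L n) :
    Cseq L γ (n + 1) = spaced (Cseq L γ n) (spacers (γ n) (L n - 1)) := by
  obtain ⟨k, rfl⟩ : ∃ k, n = k + 1 := ⟨n - 1, by omega⟩
  rw [spacers, spaced_inter, spaced_replicate_false, spaced_replicate_true,
    Nat.sub_add_cancel hL, Cseq]

lemma exists_spaced (L γ : ℕ → ℕ) (hL : ∀ n, 1 ≤ n → 2 ≤ L n) (n : ℕ) (hn : 1 ≤ n) (d : ℕ) :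
    ∃ s, Cseq L γ (n + d) = spaced (Cseq L γ n) s := by
  induction d with
  | zero => exact ⟨[], by simp [spaced]⟩
  | succ d ih =>
    obtain ⟨s, hs⟩ := ih
    have h2 := hL (n + d) (by omega)
    exact ⟨_, by rw [← add_assoc, Cseq_succ L γ (n + d) (by omega) (by omega), hs, ← spaced_inter]⟩

lemma InLangC.exists_infix_spaced {L γ : ℕ → ℕ} (hL : ∀ n, 1 ≤ n → 2 ≤ L n) {w : List Bool}
    (hw : InLangC L γ w) (n : ℕ) (hn : 1 ≤ n) : ∃ s, w <:+: spaced (Cseq L γ n) s := by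
  obtain ⟨m, hm⟩ := hw
  obtain ⟨m, hm1, hm⟩ : ∃ m, 1 ≤ m ∧ w <:+: Cseq L γ m := by
    rcases Nat.eq_zero_or_pos m with rfl | h
    · exact ⟨1, le_rfl, hm⟩
    · exact ⟨m, h, hm⟩
  rcases le_total m n with h | h
  · obtain ⟨d, rfl⟩ := Nat.exists_eq_add_of_le h
    obtain ⟨s, hs⟩ := exists_spaced L γ hL m hm1 d
    refine ⟨[], hm.trans ?_⟩
    rw [hs]
    simp only [spaced, spacedTail_nil, List.append_nil]
    exact (List.prefix_append _ _).isInfix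
  · obtain ⟨d, rfl⟩ := Nat.exists_eq_add_of_le h
    obtain ⟨s, hs⟩ := exists_spaced L γ hL n hn d
    exact ⟨s, hs ▸ hm⟩

lemma length_inter (c s : List Bool) :
    (inter c s).length + 1 = (c.length + 1) * (s.length + 1) := by
  induction s with
  | nil => simp [inter_nil]
  | cons x s ih =>
    rw [inter_cons]
    simp only [List.length_append, List.length_cons]
    linarith

lemma inter_getElem_opt_of_not_dvd {c s : List Bool} {i : ℕ} {x : Bool}
    (h : (inter c s)[i]? = some x) (hi : ¬ (c.length + 1) ∣ i + 1) :
    (c)[i % (c.length + 1)]? = some x := by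
  induction s generalizing i with
  | nil =>
    rw [inter_nil] at h
    obtain ⟨hlt, -⟩ := List.getElem?_eq_some_iff.1 h
    rwa [Nat.mod_eq_of_lt (by omega)]
  | cons y s ih =>
    rw [inter_cons] at h
    rcases lt_trichotomy i c.length with hlt | rfl | hlt
    · rw [List.getElem?_append_left hlt] at h
      rwa [Nat.mod_eq_of_lt (by omega)]
    · exact absurd dvd_rfl hi
    · obtain ⟨j, rfl⟩ : ∃ j, i = j + (c.length + 1) := ⟨i - (c.length + 1), by omega⟩
      rw [List.getElem?_append_right (by omega),
        show j + (c.length + 1) - c.length = j + 1 by omega, List.getElem?_cons_succ] at h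
      rw [Nat.add_mod_right]
      refine ih h fun hd => hi ?_
      rw [show j + (c.length + 1) + 1 = j + 1 + (c.length + 1) by omega]
      exact hd.add dvd_rfl

lemma inter_getElem_opt_of_dvd {c s : List Bool} {i : ℕ} {x : Bool}
    (h : (inter c s)[i]? = some x) (hi : (c.length + 1) ∣ i + 1) : x ∈ s := by
  induction s generalizing i with
  | nil =>
    rw [inter_nil] at h
    obtain ⟨hlt, -⟩ := List.getElem?_eq_some_iff.1 h
    have := Nat.le_of_dvd (by omega) hi
    omega
  | cons y s ih =>
    rw [inter_cons] at h
    rcases lt_trichotomy i c.length with hlt | rfl | hlt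
    · have := Nat.le_of_dvd (by omega) hi
      omega
    · simp at h
      simp [h]
    · obtain ⟨j, rfl⟩ : ∃ j, i = j + (c.length + 1) := ⟨i - (c.length + 1), by omega⟩
      rw [List.getElem?_append_right (by omega),
        show j + (c.length + 1) - c.length = j + 1 by omega, List.getElem?_cons_succ] at h
      refine List.mem_cons_of_mem _ (ih h ?_)
      rw [show j + (c.length + 1) + 1 = j + 1 + (c.length + 1) by omega] at hi
      exact (Nat.dvd_add_left dvd_rfl).1 hi

lemma inter_eq_append {c s p q : List Bool} (h : inter c s = p ++ q)
    (hp : (c.length + 1) ∣ p.length + 1) :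
    ∃ t₁ t₂, s = t₁ ++ t₂ ∧ p = inter c t₁ ∧ q = interTail c t₂ := by
  induction s generalizing p with
  | nil =>
    rw [inter_nil] at h
    have h1 := Nat.le_of_dvd (by omega) hp
    have h2 := congrArg List.length h
    rw [List.length_append] at h2
    obtain rfl : q = [] := List.eq_nil_of_length_eq_zero (by omega)
    exact ⟨[], [], rfl, by simpa [inter_nil] using h.symm, by simp [interTail]⟩
  | cons y s ih =>
    have h1 := Nat.le_of_dvd (by omega) hp
    rw [inter_cons] at h
    obtain ⟨r, rfl, hr⟩ : ∃ r, p = c ++ r ∧ y :: inter c s = r ++ q := by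
      rcases List.append_eq_append_iff.1 h with ⟨r, hr, h'⟩ | ⟨r, hr, h'⟩
      · exact ⟨r, hr, h'⟩
      · have h2 := congrArg List.length hr
        rw [List.length_append] at h2
        obtain rfl : r = [] := List.eq_nil_of_length_eq_zero (by omega)
        exact ⟨[], by simpa using hr.symm, by simpa using h'.symm⟩
    cases r with
    | nil => exact ⟨[], y :: s, rfl, by simp [inter_nil], by simpa using hr.symm⟩
    | cons z r =>
      simp only [List.cons_append, List.cons.injEq] at hr
      obtain ⟨rfl, hr⟩ := hr
      obtain ⟨t₁, t₂, rfl, rfl, rfl⟩ := ih hr (by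
        simp only [List.length_append, List.length_cons] at hp
        rw [show c.length + (r.length + 1) + 1 = r.length + 1 + (c.length + 1) by omega] at hp
        exact (Nat.dvd_add_left dvd_rfl).1 hp)
      exact ⟨y :: t₁, t₂, rfl, by simp [inter_cons], rfl⟩

lemma length_spacers (g m : ℕ) : (spacers g m).length + 1 = (g + 1) * (m + 1) := by
  simp [spacers, length_inter]

lemma spacers_getElem_opt_eq {g m i : ℕ} {x : Bool} (h : (spacers g m)[i]? = some x) :
    x = true ↔ ¬ (g + 1) ∣ i + 1 := by
  by_cases hi : (g + 1) ∣ i + 1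
  · have := inter_getElem_opt_of_dvd h (by simpa using hi)
    have := List.eq_of_mem_replicate this
    simp [this, hi]
  · have := inter_getElem_opt_of_not_dvd h (by simpa using hi)
    have := List.eq_of_mem_replicate (List.mem_of_getElem? this)
    simp [this, hi]

lemma inter_spacers_getElem_opt_eq {g m i : ℕ} {s : List Bool} {x : Bool}
    (h : (inter (spacers g m) s)[i]? = some x) (hi : ¬ (g + 1) * (m + 1) ∣ i + 1) :
    x = true ↔ ¬ (g + 1) ∣ i + 1 := by
  have h1 := inter_getElem_opt_of_not_dvd h (by rwa [length_spacers])
  rw [length_spacers] at h1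
  rw [spacers_getElem_opt_eq h1, not_iff_not]
  have h2 : i % ((g + 1) * (m + 1)) + 1 ≡ i + 1 [MOD (g + 1)] :=
    ((Nat.mod_modEq i ((g + 1) * (m + 1))).of_mul_right _).add_right 1
  exact h2.dvd_iff dvd_rfl

lemma dvd_of_inter_spacers_false {g m i : ℕ} {s : List Bool}
    (h : (inter (spacers g m) s)[i]? = some false) : (g + 1) ∣ i + 1 := by
  by_cases hi : (g + 1) * (m + 1) ∣ i + 1
  · exact (dvd_mul_right _ _).trans hi
  · simpa using inter_spacers_getElem_opt_eq h hi

lemma dvd_of_inter_spacers_true {g m i : ℕ} {s : List Bool}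
    (h : (inter (spacers g m) s)[i]? = some true) (hi : (g + 1) ∣ i + 1) :
    (g + 1) * (m + 1) ∣ i + 1 := by
  by_contra hd
  simpa [hi] using inter_spacers_getElem_opt_eq h hd

/-- The word `1 σ`, where `σ` is the spacer word, only occurs at the obvious positions. -/
lemma inter_spacers_eq_append {g m : ℕ} (hm : 1 ≤ m) {s p q : List Bool}
    (h : inter (spacers g m) s = p ++ true :: (spacers g m ++ q)) :
    ∃ t₁ t₂, s = t₁ ++ true :: t₂ ∧ p = inter (spacers g m) t₁ ∧
      q = interTail (spacers g m) t₂ := by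
  have hlen := length_spacers g m
  have hmul : (g + 1) * 2 ≤ (g + 1) * (m + 1) := Nat.mul_le_mul_left _ (by omega)
  have hget : ∀ j, j ≤ g → (inter (spacers g m) s)[p.length + 1 + j]? =
      some (decide (j < g)) := by
    intro j hj
    have hj' : j < (spacers g m).length := by omega
    rw [h, List.getElem?_append_right (by omega),
      show p.length + 1 + j - p.length = j + 1 by omega, List.getElem?_cons_succ,
      List.getElem?_append_left hj', List.getElem?_eq_getElem hj']
    have h1 := spacers_getElem_opt_eq (List.getElem?_eq_getElem hj')
    congr 1
    rw [Bool.eq_iff_iff, h1, decide_eq_true_iff]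
    constructor
    · intro h2
      by_contra h3
      exact h2 (by rw [show j = g by omega])
    · intro h2 h3
      have := Nat.le_of_dvd (by omega) h3
      omega
  have h0 : (inter (spacers g m) s)[p.length]? = some true := by
    rw [h, List.getElem?_append_right le_rfl]
    simp
  have hd : (g + 1) ∣ p.length + 1 := by
    have h1 := dvd_of_inter_spacers_false (by simpa using hget g le_rfl)
    rw [show p.length + 1 + g + 1 = p.length + 1 + (g + 1) by omega] at h1
    exact (Nat.dvd_add_left dvd_rfl).1 h1
  obtain ⟨t₁, t₂, rfl, rfl, h2⟩ := inter_eq_append h (by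
    rw [hlen]
    exact dvd_of_inter_spacers_true h0 hd)
  cases t₂ with
  | nil => simp [interTail] at h2
  | cons x t₂ =>
    simp only [interTail_cons, List.cons.injEq, inter, List.append_cancel_left_eq] at h2
    obtain ⟨rfl, rfl⟩ := h2
    exact ⟨t₁, t₂, rfl, rfl, rfl⟩

lemma spacedTail_eq_append {a : List Bool} {s t q : List Bool}
    (h : spacedTail (false :: a) s = spacedTail (false :: a) t ++ q) :
    ∃ u, s = t ++ u ∧ q = spacedTail (false :: a) u := by
  induction t generalizing s with
  | nil => exact ⟨s, rfl, by simpa using h.symm⟩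
  | cons x t ih =>
    cases s with
    | nil => cases x <;> simp [spaced] at h
    | cons y s =>
      cases x <;> cases y <;> simp [spaced] at h
      all_goals
        obtain ⟨u, rfl, rfl⟩ := ih h
        exact ⟨u, rfl, rfl⟩

/-- Every occurrence of `1 b` in a spaced word is one of the obvious ones. -/
def Recognizable (b : List Bool) : Prop :=
  ∀ s p q, spaced b s = p ++ true :: (b ++ q) →
    ∃ s₁ s₂, s = s₁ ++ true :: s₂ ∧ p = spaced b s₁ ∧ q = spacedTail b s₂

lemma recognizable_singleton : Recognizable [false] := by
  intro s
  induction s with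
  | nil =>
    intro p q h
    rcases p with _ | ⟨x, _ | ⟨y, p⟩⟩ <;> simp [spaced] at h
  | cons x s ih =>
    intro p q h
    rcases p with _ | ⟨y, p⟩
    · simp [spaced] at h
    cases x with
    | false =>
      have h' : y = false ∧ spaced [false] s = p ++ true :: ([false] ++ q) := by
        rw [spaced, spacedTail_false] at h
        simpa [eq_comm] using h
      obtain ⟨rfl, h'⟩ := h'
      obtain ⟨s₁, s₂, rfl, rfl, rfl⟩ := ih p q h'
      exact ⟨false :: s₁, s₂, rfl, by simp [spaced], rfl⟩
    | true =>
      have h' : y = false ∧ true :: spaced [false] s = p ++ true :: ([false] ++ q) := by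
        rw [spaced, spacedTail_true] at h
        simpa [eq_comm] using h
      obtain ⟨rfl, h'⟩ := h'
      rcases p with _ | ⟨z, p⟩
      · refine ⟨[], s, rfl, by simp [spaced], ?_⟩
        simpa [spaced] using h'.symm
      · simp only [List.cons_append, List.cons.injEq] at h'
        obtain ⟨rfl, h'⟩ := h'
        obtain ⟨s₁, s₂, rfl, rfl, rfl⟩ := ih p q h'
        exact ⟨true :: s₁, s₂, rfl, by simp [spaced], rfl⟩

lemma Recognizable.spaced_spacers {a : List Bool} (hb : Recognizable (false :: a)) (g : ℕ) {m : ℕ}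
    (hm : 1 ≤ m) : Recognizable (spaced (false :: a) (spacers g m)) := by
  intro s p q h
  rw [← spaced_inter] at h
  nth_rewrite 2 [spaced] at h
  rw [List.append_assoc] at h
  obtain ⟨s₁, s₂, h1, rfl, h2⟩ := hb _ _ _ h
  obtain ⟨u, rfl, rfl⟩ := spacedTail_eq_append h2.symm
  obtain ⟨t₁, t₂, rfl, rfl, rfl⟩ := inter_spacers_eq_append hm h1
  refine ⟨t₁, t₂, rfl, spaced_inter _ _ _, ?_⟩
  have h3 := spaced_inter (false :: a) (spacers g m) t₂
  rw [inter, spaced_append] at h3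
  exact List.append_cancel_left (h3.trans rfl)

lemma Cseq_head (L γ : ℕ → ℕ) (hL : ∀ n, 1 ≤ n → 2 ≤ L n) (n : ℕ) (hn : 1 ≤ n) :
    ∃ a, Cseq L γ n = false :: a := by
  obtain ⟨d, rfl⟩ := Nat.exists_eq_add_of_le hn
  obtain ⟨s, hs⟩ := exists_spaced L γ hL 1 le_rfl d
  exact ⟨spacedTail [false] s, by rw [hs]; rfl⟩

lemma spaced_getLast {a : List Bool} (s : List Bool) :
    ∃ a', spaced (a ++ [false]) s = a' ++ [false] := by
  induction s with
  | nil => exact ⟨a, by simp [spaced]⟩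
  | cons x s ih =>
    obtain ⟨c, hc⟩ := ih
    cases x
    · exact ⟨a ++ [false] ++ c, by rw [spaced, spacedTail_false, hc]; simp⟩
    · exact ⟨a ++ [false] ++ true :: c, by rw [spaced, spacedTail_true, hc]; simp⟩

lemma Cseq_getLast (L γ : ℕ → ℕ) (hL : ∀ n, 1 ≤ n → 2 ≤ L n) (n : ℕ) (hn : 1 ≤ n) :
    ∃ a, Cseq L γ n = a ++ [false] := by
  obtain ⟨d, rfl⟩ := Nat.exists_eq_add_of_le hn
  obtain ⟨s, hs⟩ := exists_spaced L γ hL 1 le_rfl d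
  rw [hs]
  exact spaced_getLast (a := []) s

lemma recognizable_Cseq (L γ : ℕ → ℕ) (hL : ∀ n, 1 ≤ n → 2 ≤ L n) (n : ℕ) (hn : 1 ≤ n) :
    Recognizable (Cseq L γ n) := by
  induction n, hn using Nat.le_induction with
  | base => exact recognizable_singleton
  | succ n hn ih =>
    have h2 := hL n hn
    rw [Cseq_succ L γ n hn (by omega)]
    obtain ⟨a, ha⟩ := Cseq_head L γ hL n hn
    rw [ha] at ih ⊢
    exact ih.spaced_spacers _ (by omega)

lemma trailing_run (s : List Bool) :
    (∃ k, s = List.replicate k true) ∨ ∃ r k, s = r ++ false :: List.replicate k true := by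
  induction s with
  | nil => exact .inl ⟨0, rfl⟩
  | cons x s ih =>
    rcases ih with ⟨k, rfl⟩ | ⟨r, k, rfl⟩
    · cases x
      · exact .inr ⟨[], k, rfl⟩
      · exact .inl ⟨k + 1, rfl⟩
    · exact .inr ⟨x :: r, k, rfl⟩

lemma true_cons_suffix {b : List Bool} {k k' : ℕ} (h : k < k') :
    true :: spaced b (List.replicate k true) <:+ spaced b (List.replicate k' true) := by
  obtain ⟨d, rfl⟩ := Nat.exists_eq_add_of_lt h
  refine ⟨spaced b (List.replicate d true), ?_⟩
  rw [show k + d + 1 = d + (k + 1) by omega, List.replicate_add, spaced_append,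
    List.replicate_succ, spacedTail_true]

lemma not_false_true_suffix {x y : List Bool} (h : false :: x <:+ y) : ¬ true :: x <:+ y := by
  intro h'
  have := (List.suffix_of_suffix_length_le h h' (by simp)).eq_of_length (by simp)
  simp at this

lemma spaced_replicate_suffix {b : List Bool} {k k' : ℕ} (h : k ≤ k') :
    spaced b (List.replicate k true) <:+ spaced b (List.replicate k' true) := by
  rcases h.eq_or_lt with rfl | h
  · exact List.suffix_rfl
  · exact (List.suffix_cons _ _).trans (true_cons_suffix h)

lemma run_eq_of_suffix {a s : List Bool} {k : ℕ}
    (h : false :: spaced (a ++ [false]) (List.replicate k true) <:+ spaced (a ++ [false]) s) :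
    ∃ r, s = r ++ false :: List.replicate k true := by
  rcases trailing_run s with ⟨k', rfl⟩ | ⟨r, k', rfl⟩
  · rcases lt_or_ge k k' with hk | hk
    · exact absurd (true_cons_suffix hk) (not_false_true_suffix h)
    · have h1 := h.length_le
      have h2 := (spaced_replicate_suffix (b := a ++ [false]) hk).length_le
      rw [List.length_cons] at h1
      omega
  · rw [spaced_append, spacedTail_false] at h
    rcases lt_trichotomy k k' with hk | rfl | hk
    · exact absurd ((true_cons_suffix hk).trans (List.suffix_append _ _))
        (not_false_true_suffix h)
    · exact ⟨r, rfl⟩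
    · obtain ⟨c, hc⟩ := spaced_getLast (a := a) r
      rw [hc, List.append_assoc] at h
      exact absurd ((true_cons_suffix hk).trans ((List.suffix_cons _ _).trans h))
        (not_false_true_suffix (List.suffix_append _ _))

lemma getElem_opt_run {p q : List Bool} {j : ℕ} (i : ℕ) (hi : i < j) :
    (p ++ (List.replicate j true ++ q))[p.length + i]? = some true := by
  rw [List.getElem?_append_right (by omega), List.getElem?_append_left (by simp; omega)]
  simp [hi]

lemma initial_run_bound {g m k : ℕ} (hm : 1 ≤ m) {s q : List Bool}
    (h : inter (spacers g m) s = List.replicate k true ++ true :: true :: q) : k + 2 ≤ g := by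
  by_contra! hk
  have h1 : (inter (spacers g m) s)[g]? = some true := by
    have := getElem_opt_run (p := []) (q := q) (j := k + 2) g hk
    rw [h]
    simpa [List.replicate_add] using this
  have h2 := Nat.le_of_dvd (by omega) (dvd_of_inter_spacers_true h1 dvd_rfl)
  have : (g + 1) * 2 ≤ (g + 1) * (m + 1) := Nat.mul_le_mul_left _ (by omega)
  omega

lemma run_bound {g m k : ℕ} (hm : 1 ≤ m) {s r q : List Bool}
    (h : inter (spacers g m) s =
      (r ++ false :: List.replicate k true) ++ true :: true :: q) :
    k + 1 ≤ 2 * g ∧ (k + 1 = g →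
      ∃ t, (r ++ false :: List.replicate k true) ++ [true] = inter (spacers g m) t) := by
  have hlen := length_spacers g m
  have hmul : (g + 1) * 2 ≤ (g + 1) * (m + 1) := Nat.mul_le_mul_left _ (by omega)
  have h0 : (g + 1) ∣ r.length + 1 := dvd_of_inter_spacers_false (s := s) (m := m) (by
    rw [h, List.append_assoc, List.getElem?_append_right le_rfl]
    simp)
  have h1 : ∀ i < k + 2, (inter (spacers g m) s)[r.length + 1 + i]? = some true := by
    intro i hi
    have := getElem_opt_run (p := r ++ [false]) (q := q) i hi
    rw [h]
    simpa [List.replicate_add] using this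
  have h2 : g < k + 2 → (g + 1) * (m + 1) ∣ r.length + 1 + g + 1 := fun hk =>
    dvd_of_inter_spacers_true (h1 g hk) (by
      rw [show r.length + 1 + g + 1 = r.length + 1 + (g + 1) by omega]
      exact h0.add dvd_rfl)
  constructor
  · by_contra! hk
    have h3 := dvd_of_inter_spacers_true (h1 (2 * g + 1) (by omega)) (by
      rw [show r.length + 1 + (2 * g + 1) + 1 = r.length + 1 + (g + 1) + (g + 1) by omega]
      exact (h0.add dvd_rfl).add dvd_rfl)
    rw [show r.length + 1 + (2 * g + 1) + 1 = r.length + 1 + g + 1 + (g + 1) by omega] at h3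
    have := Nat.le_of_dvd (by omega) ((Nat.dvd_add_right (h2 (by omega))).1 h3)
    omega
  · intro hk
    have h4 : inter (spacers g m) s =
        ((r ++ false :: List.replicate k true) ++ [true]) ++ true :: q := by simp [h]
    obtain ⟨t, -, -, ht, -⟩ := inter_eq_append h4 (by
      rw [hlen]
      convert h2 (by omega) using 1
      simp
      omega)
    exact ⟨t, ht⟩

lemma dvd_of_complete_run {g m k : ℕ} {s r q : List Bool}
    (h : inter (spacers g m) s =
      (r ++ false :: List.replicate k true) ++ true :: false :: q) : (g + 1) ∣ k + 2 := by
  have h0 : (g + 1) ∣ r.length + 1 := dvd_of_inter_spacers_false (s := s) (m := m) (by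
    rw [h, List.append_assoc, List.getElem?_append_right le_rfl]
    simp)
  have h1 : (g + 1) ∣ (r.length + 1 + k + 1) + 1 :=
    dvd_of_inter_spacers_false (s := s) (m := m) (by
      rw [h, List.getElem?_append_right (by simp; omega)]
      simp only [List.length_append, List.length_cons, List.length_replicate]
      rw [show r.length + 1 + k + 1 - (r.length + (k + 1)) = 1 by omega]
      simp)
  rw [show r.length + 1 + k + 1 + 1 = r.length + 1 + (k + 2) by omega] at h1
  exact (Nat.dvd_add_right h0).1 h1

/-- In a spaced word whose spacers are recognizable, `v 1 b x` determines the next spacer `x`. -/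
lemma Recognizable.exists_next {a : List Bool} (hb : Recognizable (false :: a)) {s v : List Bool}
    {x : Bool} (h : (v ++ true :: (false :: a)) ++ [x] <:+: spaced (false :: a) s) :
    ∃ s₁ q, s = s₁ ++ true :: x :: q ∧ v <:+ spaced (false :: a) s₁ := by
  obtain ⟨p, q, h⟩ := h
  obtain ⟨s₁, s₂, rfl, h1, h2⟩ := hb s (p ++ v) (x :: q) (by simp [← h])
  rcases s₂ with _ | ⟨y, s₂⟩
  · simp at h2
  · obtain rfl : x = y := by cases y <;> simp_all [spaced]
    exact ⟨s₁, s₂, rfl, p, h1⟩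

lemma spaced_concat_true (b s : List Bool) :
    spaced b (s ++ [true]) = spaced b s ++ true :: b := by
  rw [spaced_append]
  simp [spaced]

lemma suffix_spaced (b s : List Bool) : b <:+ spaced b s := by
  induction s with
  | nil => simp [spaced]
  | cons x s ih =>
    cases x
    · rw [spaced, spacedTail_false]
      exact ih.trans (List.suffix_append _ _)
    · rw [spaced, spacedTail_true]
      exact ih.trans ((List.suffix_cons _ _).trans (List.suffix_append _ _))

lemma rightSpecial_suffix {b v s s' : List Bool} {g m : ℕ} (hm : 1 ≤ m) (hg : 1 ≤ g)
    (hb : Recognizable b) (ha : ∃ a, b = false :: a) (hlast : ∃ a, b = a ++ [false])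
    (h1 : (v ++ true :: b) ++ [true] <:+: spaced b (inter (spacers g m) s))
    (h0 : (v ++ true :: b) ++ [false] <:+: spaced b (inter (spacers g m) s')) :
    v ++ true :: b <:+ spaced b (List.replicate (2 * g) true) ∨
      ∃ t, v ++ true :: b <:+ spaced (spaced b (spacers g m)) t := by
  have hsuf : ∀ s, v <:+ spaced b s → v ++ true :: b <:+ spaced b (s ++ [true]) := by
    rintro s ⟨p, hp⟩
    exact ⟨p, by rw [spaced_concat_true, ← hp]; simp⟩
  obtain ⟨s₁, q, e1, hv1⟩ : ∃ s₁ q, inter (spacers g m) s = s₁ ++ true :: true :: q ∧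
      v <:+ spaced b s₁ := by
    obtain ⟨a, rfl⟩ := ha
    exact hb.exists_next h1
  obtain ⟨s₁', q', e0, hv0⟩ : ∃ s₁ q, inter (spacers g m) s' = s₁ ++ true :: false :: q ∧
      v <:+ spaced b s₁ := by
    obtain ⟨a, rfl⟩ := ha
    exact hb.exists_next h0
  have hrun : ∀ k, k + 1 ≤ 2 * g → v <:+ spaced b (List.replicate k true) →
      v ++ true :: b <:+ spaced b (List.replicate (2 * g) true) := by
    intro k hk hv
    have := hsuf _ hv
    rw [← List.replicate_succ'] at this
    exact this.trans (spaced_replicate_suffix hk)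
  rcases trailing_run s₁ with ⟨k, rfl⟩ | ⟨r, k, rfl⟩
  · have := initial_run_bound hm e1
    exact .inl (hrun k (by omega) hv1)
  · obtain ⟨hk, ht⟩ := run_bound hm e1
    by_cases hvk : v <:+ spaced b (List.replicate k true)
    · exact .inl (hrun k hk hvk)
    · right
      obtain ⟨a, rfl⟩ := hlast
      obtain ⟨c, hc⟩ := spaced_getLast (a := a) r
      have hfalse : false :: spaced (a ++ [false]) (List.replicate k true) <:+ v := by
        have h2 := hv1
        rw [spaced_append, spacedTail_false, hc, List.append_assoc] at h2
        refine List.suffix_of_suffix_length_le (List.suffix_append c _) h2 ?_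
        by_contra! hl
        refine hvk (List.suffix_of_suffix_length_le h2
          ((List.suffix_cons _ _).trans (List.suffix_append _ _)) ?_)
        rw [List.length_cons] at hl
        omega
      obtain ⟨r', rfl⟩ := run_eq_of_suffix (hfalse.trans hv0)
      obtain ⟨d, hd⟩ := dvd_of_complete_run e0
      have hd1 : d = 1 := by
        have : d < 2 := by
          by_contra! hd2
          have := Nat.mul_le_mul_left (g + 1) hd2
          omega
        interval_cases d <;> omega
      subst hd1
      obtain ⟨t, ht⟩ := ht (by omega)
      refine ⟨t, ?_⟩
      rw [← spaced_inter, ← ht]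
      exact hsuf _ hv1

/-- If `w` is right-special and has `1 B_n` as a suffix, then `w` is a suffix of
`(B_n 1)^{2 γ_n} B_n`, or `w` is a suffix of `B_{n+1}`, or `w` has `B_{n+1}` as a
proper suffix. -/
theorem stmt13 (L γ : ℕ → ℕ) (hL : ∀ n, 1 ≤ n → 2 ≤ L n) (hγ : ∀ n, 1 ≤ n → 2 ≤ γ n)
    (n : ℕ) (hn : 1 ≤ n) (w : List Bool) (hrs : RightSpecialC L γ w)
    (hsuf : (true :: Cseq L γ n) <:+ w) :
    w <:+ ((List.replicate (2 * γ n) (Cseq L γ n ++ [true])).flatten ++ Cseq L γ n) ∨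
      w <:+ Cseq L γ (n + 1) ∨
      (Cseq L γ (n + 1) <:+ w ∧ Cseq L γ (n + 1) ≠ w) := by
  obtain ⟨v, rfl⟩ := hsuf
  have hLn := hL n hn
  have hγn := hγ n hn
  have hB := Cseq_succ L γ n hn (by omega)
  obtain ⟨s', h0⟩ := hrs.1.exists_infix_spaced hL (n + 1) (by omega)
  obtain ⟨s, h1⟩ := hrs.2.exists_infix_spaced hL (n + 1) (by omega)
  rw [hB, ← spaced_inter] at h0 h1
  rw [← spaced_replicate_true]
  rcases rightSpecial_suffix (by omega) (by omega) (recognizable_Cseq L γ hL n hn)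
    (Cseq_head L γ hL n hn) (Cseq_getLast L γ hL n hn) h1 h0 with h | ⟨t, h⟩
  · exact .inl h
  · right
    rw [← hB] at h
    have h2 : Cseq L γ (n + 1) <:+ spaced (Cseq L γ (n + 1)) t := suffix_spaced _ _
    rcases List.suffix_or_suffix_of_suffix h h2 with h3 | h3
    · exact .inl h3
    · by_cases he : Cseq L γ (n + 1) = v ++ true :: Cseq L γ n
      · exact .inl (he ▸ List.suffix_rfl)
      · exact .inr ⟨h3, he⟩
end

section
/- The complexity function satisfies p(h_2 + 1) = h_2 (1 + 1/L_1) + 1, and for every q > h_2, letting n be the unique integer with h_n < q <= h_{n+1}: p(q+1) - p(q) = 2 if h_n < q <= (2 - 1/L_{n-1}) h_n; p(q+1) - p(q) = 1 if (2 - 1/L_{n-1}) h_n < q <= (gamma_n + 1) h_n + gamma_n; p(q+1) - p(q) = 2 if (gamma_n + 1) h_n + gamma_n < q <= (2 gamma_n + 1) h_n + 2 gamma_n; and p(q+1) - p(q) = 1 if (2 gamma_n + 1) h_n + 2 gamma_n < q <= h_{n+1}. -/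
namespace Cseq

/-! ### Suffixes of lists -/

theorem suffix_append_cases {α : Type*} {w X F : List α} (h : w <:+ X ++ F) :
    w <:+ F ∨ ∃ w', w = w' ++ F ∧ w' <:+ X := by
  obtain ⟨t, ht⟩ := h
  rcases List.append_eq_append_iff.mp ht with ⟨a, h1, h2⟩ | ⟨c, h1, h2⟩
  · exact Or.inr ⟨a, h2, t, h1.symm⟩
  · exact Or.inl ⟨c, h2.symm⟩

theorem suffix_of_concat_suffix {α : Type*} {w X : List α} {a b : α}
    (h : w ++ [a] <:+ X ++ [b]) : a = b ∧ w <:+ X := by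
  obtain ⟨t, ht⟩ := h
  rw [← List.append_assoc] at ht
  obtain ⟨h1, h2⟩ := List.append_inj' ht rfl
  exact ⟨by simpa using h2, t, h1⟩

theorem eq_nil_of_suffix_of_ne {α : Type*} {w X Y : List α} {a b : α} (hab : a ≠ b)
    (h1 : w <:+ X ++ [a]) (h2 : w <:+ Y ++ [b]) : w = [] := by
  rcases List.eq_nil_or_concat w with h | ⟨v, c, h⟩
  · exact h
  · rw [List.concat_eq_append] at h
    subst h
    exact absurd ((suffix_of_concat_suffix h1).1.symm.trans (suffix_of_concat_suffix h2).1) hab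

theorem suffix_of_common_suffix {α : Type*} {w X Y z : List α} {a b : α} (hab : a ≠ b)
    (h1 : w <:+ X ++ a :: z) (h2 : w <:+ Y ++ b :: z) : w <:+ z := by
  have e : ∀ (X : List α) a, X ++ a :: z = (X ++ [a]) ++ z := by simp
  rw [e] at h1 h2
  rcases suffix_append_cases h1 with h | ⟨w1, rfl, hX⟩
  · exact h
  rcases suffix_append_cases h2 with h | ⟨w2, he, hY⟩
  · exact h
  obtain rfl := List.append_cancel_right he
  simp [eq_nil_of_suffix_of_ne hab hX hY]

/-! ### Factorial languages and their images under morphisms -/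

/-- A language closed under taking factors. -/
def Factorial (P : Set (List Bool)) : Prop :=
  ∀ ⦃v w⦄, w ∈ P → v <:+: w → v ∈ P

/-- A language all of whose words extend to the left. -/
def LeftExt (P : Set (List Bool)) : Prop :=
  ∀ w ∈ P, ∃ a, a :: w ∈ P

/-- The words that can be continued by both letters within `P`. -/
def RightSpecial (P : Set (List Bool)) (w : List Bool) : Prop :=
  w ++ [false] ∈ P ∧ w ++ [true] ∈ P

/-- The factors of images of words of `P` under the morphism `f`. -/
def image (f : Bool → List Bool) (P : Set (List Bool)) : Set (List Bool) :=
  {w | ∃ y ∈ P, w <:+: y.flatMap f}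

theorem image_factorial (f : Bool → List Bool) (P : Set (List Bool)) : Factorial (image f P) :=
  fun _ _ ⟨y, hy, h⟩ hv => ⟨y, hy, hv.trans h⟩

theorem RightSpecial.suffix {P : Set (List Bool)} (hP : Factorial P) {v w : List Bool}
    (hw : RightSpecial P w) (h : v <:+ w) : RightSpecial P v := by
  obtain ⟨t, rfl⟩ := h
  exact ⟨hP hw.1 ⟨t, [], by simp⟩, hP hw.2 ⟨t, [], by simp⟩⟩

theorem image_leftExt {f : Bool → List Bool} {P : Set (List Bool)} (hf : ∀ a, f a ≠ [])
    (hP : LeftExt P) : LeftExt (image f P) := by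
  rintro w ⟨y, hy, s, t, h⟩
  obtain ⟨a, ha⟩ := hP y hy
  rcases List.eq_nil_or_concat (f a ++ s) with h' | ⟨r, b, h'⟩
  · simp [hf] at h'
  · refine ⟨b, a :: y, ha, r, t, ?_⟩
    rw [List.concat_eq_append] at h'
    rw [List.flatMap_cons, ← h, ← List.append_assoc, ← List.append_assoc, h']
    simp

theorem exists_cut_of_flatMap_eq {f : Bool → List Bool} {c : Bool} {t : List Bool} :
    ∀ {y s : List Bool}, y.flatMap f = s ++ c :: t →
      ∃ y₁ a y₂ p q, y = y₁ ++ a :: y₂ ∧ f a = p ++ c :: q ∧ s = y₁.flatMap f ++ p := by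
  intro y
  induction y with
  | nil => intro s h; simp at h
  | cons b y ih =>
    intro s h
    rw [List.flatMap_cons] at h
    rcases List.append_eq_append_iff.mp h with ⟨r, h1, h2⟩ | ⟨r, h1, h2⟩
    · obtain ⟨y₁, a, y₂, p, q, rfl, h4, rfl⟩ := ih h2
      exact ⟨b :: y₁, a, y₂, p, q, by simp, h4, by simp [h1]⟩
    · rcases List.cons_eq_append_iff.mp h2 with ⟨rfl, h3⟩ | ⟨r', rfl, h3⟩
      · obtain ⟨y₁, a, y₂, p, q, rfl, h4, h5⟩ := ih (s := []) (by simpa using h3)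
        refine ⟨b :: y₁, a, y₂, p, q, by simp, h4, ?_⟩
        rw [List.flatMap_cons, List.append_assoc, ← h5]
        simpa using h1.symm
      · exact ⟨[], b, y, s, r', by simp, h1, by simp⟩

theorem exists_cut {f : Bool → List Bool} {P : Set (List Bool)} (hP : Factorial P)
    {w : List Bool} {c : Bool} (h : w ++ [c] ∈ image f P) :
    ∃ y a p q, y ++ [a] ∈ P ∧ f a = p ++ c :: q ∧ w <:+ y.flatMap f ++ p := by
  obtain ⟨y, hy, s, t, h⟩ := h
  obtain ⟨y₁, a, y₂, p, q, rfl, h4, h5⟩ :=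
    exists_cut_of_flatMap_eq (f := f) (y := y) (s := s ++ w) (c := c) (t := t) (by simp [← h])
  exact ⟨y₁, a, p, q, hP hy ⟨[], y₂, by simp⟩, h4, s, h5⟩

/-- Each letter is the last letter of its own image. -/
def EndsInSelf (f : Bool → List Bool) : Prop :=
  ∀ a, ∃ e, f a = e ++ [a]

theorem EndsInSelf.exists_common_suffix {f : Bool → List Bool} (hf : EndsInSelf f) :
    ∀ {y₁ y₂ w : List Bool}, w <:+ y₁.flatMap f → w <:+ y₂.flatMap f →
      ∃ v, v <:+ y₁ ∧ v <:+ y₂ ∧ w <:+ v.flatMap f := by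
  intro y₁
  induction y₁ using List.reverseRecOn with
  | nil => intro y₂ w h1 _; exact ⟨[], by simp, by simp, h1⟩
  | append_singleton y a ih =>
    intro y₂ w h1 h2
    rcases List.eq_nil_or_concat y₂ with rfl | ⟨z, b, rfl⟩
    · exact ⟨[], by simp, by simp, h2⟩
    rw [List.concat_eq_append] at h2 ⊢
    by_cases hab : a = b
    · subst hab
      simp only [List.flatMap_append, List.flatMap_singleton] at h1 h2
      rcases suffix_append_cases h1 with h | ⟨w1, rfl, hX⟩
      · exact ⟨[a], by simp, by simp, by simpa using h⟩
      rcases suffix_append_cases h2 with h | ⟨w2, he, hY⟩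
      · exact ⟨[a], by simp, by simp, by simpa using h⟩
      obtain rfl := List.append_cancel_right he
      obtain ⟨v, ⟨s, hs⟩, ⟨t, ht⟩, k3⟩ := ih hX hY
      refine ⟨v ++ [a], ⟨s, by simp [← hs]⟩, ⟨t, by simp [← ht]⟩, ?_⟩
      obtain ⟨r, hr⟩ := k3
      exact ⟨r, by simp [← hr]⟩
    · obtain ⟨e, he⟩ := hf a
      obtain ⟨e', he'⟩ := hf b
      rw [List.flatMap_append, List.flatMap_singleton, he, ← List.append_assoc] at h1
      rw [List.flatMap_append, List.flatMap_singleton, he', ← List.append_assoc] at h2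
      exact ⟨[], by simp, by simp, by simp [eq_nil_of_suffix_of_ne hab h1 h2]⟩

theorem exists_rightSpecial_of_suffix {f : Bool → List Bool} (hf : EndsInSelf f)
    {P : Set (List Bool)} (hP : Factorial P) {y₁ y₂ w : List Bool}
    (h1 : y₁ ++ [false] ∈ P) (h2 : y₂ ++ [true] ∈ P)
    (k1 : w <:+ y₁.flatMap f) (k2 : w <:+ y₂.flatMap f) :
    ∃ v, RightSpecial P v ∧ w <:+ v.flatMap f := by
  obtain ⟨v, ⟨s, rfl⟩, ⟨t, rfl⟩, hv⟩ := hf.exists_common_suffix k1 k2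
  exact ⟨v, ⟨hP h1 ⟨s, [], by simp⟩, hP h2 ⟨t, [], by simp⟩⟩, hv⟩

/-! ### The two elementary morphisms -/

/-- The morphism `0 ↦ 0 ^ l`, `1 ↦ 1`. -/
def powMor (l : ℕ) (a : Bool) : List Bool :=
  bif a then [true] else List.replicate l false

/-- The word `(w1) ^ k w`. -/
def spaced (w : List Bool) (k : ℕ) : List Bool :=
  (List.replicate k (w ++ [true])).flatten ++ w

theorem spaced_succ (w : List Bool) (k : ℕ) : spaced w (k + 1) = w ++ true :: spaced w k := by
  simp [spaced, List.replicate_succ]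

theorem spaced_append_spaced (w : List Bool) (k m : ℕ) :
    spaced w k ++ true :: spaced w m = spaced w (k + m + 1) := by
  induction k with
  | zero => rw [spaced_succ]; simp [spaced]
  | succ k ih =>
    rw [spaced_succ, List.append_assoc, List.cons_append, ih, ← spaced_succ]
    congr 1
    omega

theorem spaced_flatMap (w : List Bool) (k : ℕ) {f : Bool → List Bool} (hf : f true = [true]) :
    (spaced w k).flatMap f = spaced (w.flatMap f) k := by
  induction k with
  | zero => simp [spaced]
  | succ k ih => simp [spaced_succ, ih, hf]

theorem length_spaced (w : List Bool) (k : ℕ) :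
    (spaced w k).length = (k + 1) * w.length + k := by
  induction k with
  | zero => simp [spaced]
  | succ k ih => simp only [spaced_succ, List.length_append, List.length_cons, ih]; ring

/-- The alternating word `(01) ^ k 0`. -/
def zig (k : ℕ) : List Bool :=
  spaced [false] k

/-- The morphism `0 ↦ (01) ^ g 0`, `1 ↦ 1`. -/
def spaceMor (g : ℕ) (a : Bool) : List Bool :=
  bif a then [true] else zig g

theorem zig_succ (k : ℕ) : zig (k + 1) = false :: true :: zig k :=
  spaced_succ [false] k

theorem zig_append_zig (k m : ℕ) : zig k ++ true :: zig m = zig (k + m + 1) :=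
  spaced_append_spaced [false] k m

@[simp] theorem powMor_true (l : ℕ) : powMor l true = [true] := rfl
@[simp] theorem powMor_false (l : ℕ) : powMor l false = List.replicate l false := rfl
@[simp] theorem spaceMor_true (g : ℕ) : spaceMor g true = [true] := rfl
@[simp] theorem spaceMor_false (g : ℕ) :
    spaceMor g false = zig g := rfl

theorem powMor_endsInSelf {l : ℕ} (hl : 1 ≤ l) : EndsInSelf (powMor l) := by
  rintro (_ | _)
  · obtain ⟨k, rfl⟩ := Nat.exists_eq_add_of_le' hl
    exact ⟨List.replicate k false, by simp [List.replicate_succ']⟩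
  · exact ⟨[], rfl⟩

theorem spaceMor_endsInSelf (g : ℕ) : EndsInSelf (spaceMor g) := by
  rintro (_ | _)
  · exact ⟨_, rfl⟩
  · exact ⟨[], rfl⟩

theorem EndsInSelf.ne_nil {f : Bool → List Bool} (hf : EndsInSelf f) (a : Bool) : f a ≠ [] := by
  obtain ⟨e, he⟩ := hf a
  simp [he]

theorem EndsInSelf.concat_mem {f : Bool → List Bool} (hf : EndsInSelf f) {y w : List Bool}
    {c : Bool} (h : w ++ [c] <:+ y.flatMap f) : ∃ z, y = z ++ [c] := by
  rcases List.eq_nil_or_concat y with rfl | ⟨z, b, rfl⟩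
  · simp at h
  · obtain ⟨e, he⟩ := hf b
    rw [List.concat_eq_append, List.flatMap_append, List.flatMap_singleton, he,
      ← List.append_assoc] at h
    rw [(suffix_of_concat_suffix h).1, List.concat_eq_append]
    exact ⟨z, rfl⟩

theorem replicate_eq_append_cons {l : ℕ} {a c : Bool} {p q : List Bool}
    (h : List.replicate l a = p ++ c :: q) : c = a ∧ ∃ j < l, p = List.replicate j a := by
  rw [eq_comm, List.append_eq_replicate_iff] at h
  obtain ⟨h1, h2, h3⟩ := h
  rw [List.eq_replicate_iff] at h3
  exact ⟨h3.2 c (by simp), p.length, by simp at h1; omega, h2⟩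

theorem zig_eq_append_cons {c : Bool} {q : List Bool} :
    ∀ {g : ℕ} {p : List Bool},
      zig g = p ++ c :: q →
      (c = false ∧ ∃ j, p = (List.replicate j [false, true]).flatten) ∨
      (c = true ∧ ∃ j < g, p = zig j) := by
  intro g
  induction g with
  | zero =>
    intro p h
    rcases p with _ | ⟨a, p⟩
    · exact Or.inl ⟨by simp_all [zig, spaced], 0, by simp⟩
    · simp [zig, spaced] at h
  | succ g ih =>
    intro p h
    rw [zig_succ] at h
    rcases p with _ | ⟨a, _ | ⟨b, p⟩⟩
    · exact Or.inl ⟨by simp_all, 0, by simp⟩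
    · obtain ⟨rfl, rfl, -⟩ : false = a ∧ true = c ∧ zig g = q := by simpa using h
      exact Or.inr ⟨rfl, 0, by omega, rfl⟩
    · simp only [List.cons_append, List.cons.injEq] at h
      obtain ⟨rfl, rfl, h⟩ := h
      rcases ih h with ⟨h1, j, rfl⟩ | ⟨h1, j, hj, rfl⟩
      · exact Or.inl ⟨h1, j + 1, by simp [List.replicate_succ]⟩
      · exact Or.inr ⟨h1, j + 1, by omega, by simp [zig_succ]⟩

theorem powMor_cut_false {l : ℕ} {P : Set (List Bool)} (hP : Factorial P) {w : List Bool}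
    (h : w ++ [false] ∈ image (powMor l) P) :
    ∃ y j, y ++ [false] ∈ P ∧ j < l ∧ w <:+ y.flatMap (powMor l) ++ List.replicate j false := by
  obtain ⟨y, _ | _, p, q, hy, hp, hw⟩ := exists_cut hP h
  · obtain ⟨-, j, hj, rfl⟩ := replicate_eq_append_cons hp
    exact ⟨y, j, hy, hj, hw⟩
  · simp [List.singleton_eq_append_iff] at hp

theorem powMor_cut_true {l : ℕ} {P : Set (List Bool)} (hP : Factorial P) {w : List Bool}
    (h : w ++ [true] ∈ image (powMor l) P) :
    ∃ y, y ++ [true] ∈ P ∧ w <:+ y.flatMap (powMor l) := by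
  obtain ⟨y, _ | _, p, q, hy, hp, hw⟩ := exists_cut hP h
  · exact absurd (replicate_eq_append_cons hp).1 (by simp)
  · obtain ⟨rfl, -⟩ : p = [] ∧ q = [] := by simpa [List.singleton_eq_append_iff] using hp
    exact ⟨y, hy, by simpa using hw⟩

theorem spaceMor_cut_false {g : ℕ} {P : Set (List Bool)} (hP : Factorial P) {w : List Bool}
    (h : w ++ [false] ∈ image (spaceMor g) P) :
    ∃ y j, y ++ [false] ∈ P ∧
      w <:+ y.flatMap (spaceMor g) ++ (List.replicate j [false, true]).flatten := by
  obtain ⟨y, _ | _, p, q, hy, hp, hw⟩ := exists_cut hP h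
  · rcases zig_eq_append_cons hp with ⟨-, j, rfl⟩ | ⟨h, -⟩
    · exact ⟨y, j, hy, hw⟩
    · simp at h
  · simp [List.singleton_eq_append_iff] at hp

theorem spaceMor_cut_true {g : ℕ} {P : Set (List Bool)} (hP : Factorial P) {w : List Bool}
    (h : w ++ [true] ∈ image (spaceMor g) P) :
    (∃ y, y ++ [true] ∈ P ∧ w <:+ y.flatMap (spaceMor g)) ∨
    ∃ y, ∃ j < g, y ++ [false] ∈ P ∧
      w <:+ y.flatMap (spaceMor g) ++ zig j := by
  obtain ⟨y, _ | _, p, q, hy, hp, hw⟩ := exists_cut hP h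
  · rcases zig_eq_append_cons hp with ⟨h, -⟩ | ⟨-, j, hj, rfl⟩
    · simp at h
    · exact Or.inr ⟨y, j, hj, hy, hw⟩
  · obtain ⟨rfl, -⟩ : p = [] ∧ q = [] := by simpa [List.singleton_eq_append_iff] using hp
    exact Or.inl ⟨y, hy, by simpa using hw⟩

theorem LeftExt.exists_append {P : Set (List Bool)} (hP : LeftExt P) {y t : List Bool}
    (h : y ++ t ∈ P) :
    ∃ r a b c d, (r ++ [a, b, c, d]) ++ t ∈ P ∧ y <:+ r ++ [a, b, c, d] := by
  obtain ⟨a₁, h1⟩ := hP _ h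
  obtain ⟨a₂, h2⟩ := hP _ h1
  obtain ⟨a₃, h3⟩ := hP _ h2
  obtain ⟨a₄, h4⟩ := hP _ h3
  have key : ∀ z : List Bool, 4 ≤ z.length → ∃ r a b c d, z = r ++ [a, b, c, d] := by
    intro z hz
    have hd : (z.drop (z.length - 4)).length = 4 := by simp; omega
    obtain ⟨a, b, c, d, habc⟩ := List.length_eq_four.mp hd
    exact ⟨z.take (z.length - 4), a, b, c, d, by rw [← habc, List.take_append_drop]⟩
  obtain ⟨r, a, b, c, d, hr⟩ := key (a₄ :: a₃ :: a₂ :: a₁ :: y) (by simp)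
  exact ⟨r, a, b, c, d, by rw [← hr]; simpa using h4,
    by rw [← hr]; exact ⟨[a₄, a₃, a₂, a₁], rfl⟩⟩

theorem suffix_flatMap {y z : List Bool} (f : Bool → List Bool) (h : y <:+ z) :
    y.flatMap f <:+ z.flatMap f := by
  obtain ⟨t, rfl⟩ := h
  exact ⟨t.flatMap f, by simp⟩

theorem powMor_no_true_true {l : ℕ} (hl : 1 ≤ l) {P : Set (List Bool)} (hP : Factorial P)
    (h11 : [true, true] ∉ P) : [true, true] ∉ image (powMor l) P := by
  intro h
  obtain ⟨y, hy, hw⟩ := powMor_cut_true (w := [true]) hP h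
  obtain ⟨z, rfl⟩ := (powMor_endsInSelf hl).concat_mem (w := []) hw
  exact h11 (hP hy ⟨z, [], by simp⟩)

theorem powMor_no_true_false_true {l : ℕ} (hl : 2 ≤ l) {P : Set (List Bool)} (hP : Factorial P) :
    [true, false, true] ∉ image (powMor l) P := by
  intro h
  obtain ⟨y, hy, hw⟩ := powMor_cut_true (w := [true, false]) hP h
  obtain ⟨z, rfl⟩ := (powMor_endsInSelf (by omega)).concat_mem (w := [true]) hw
  obtain ⟨k, rfl⟩ := Nat.exists_eq_add_of_le' hl
  rw [List.flatMap_append, List.flatMap_singleton, powMor_false, List.replicate_succ',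
    List.replicate_succ', ← List.append_assoc, ← List.append_assoc] at hw
  have := (suffix_of_concat_suffix (w := [true]) hw).2
  have := (suffix_of_concat_suffix (w := []) this).1
  simp at this

theorem spaceMor_no_true_true {g : ℕ} {P : Set (List Bool)} (hP : Factorial P)
    (h11 : [true, true] ∉ P) : [true, true] ∉ image (spaceMor g) P := by
  intro h
  rcases spaceMor_cut_true (w := [true]) hP h with ⟨y, hy, hw⟩ | ⟨y, j, hj, hy, hw⟩
  · obtain ⟨z, rfl⟩ := (spaceMor_endsInSelf g).concat_mem (w := []) hw
    exact h11 (hP hy ⟨z, [], by simp⟩)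
  · rw [zig, spaced, ← List.append_assoc] at hw
    have := (suffix_of_concat_suffix (w := []) hw).1
    simp at this

theorem spaceMor_no_false_pow_three {g : ℕ} (hg : 1 ≤ g) {P : Set (List Bool)}
    (hP : Factorial P) : [false, false, false] ∉ image (spaceMor g) P := by
  intro h
  obtain ⟨y, j, hy, hw⟩ := spaceMor_cut_false (w := [false, false]) hP h
  rcases j with _ | j
  · rw [List.replicate_zero, List.flatten_nil, List.append_nil] at hw
    obtain ⟨z, rfl⟩ := (spaceMor_endsInSelf g).concat_mem (w := [false]) hw
    obtain ⟨k, rfl⟩ := Nat.exists_eq_add_of_le' hg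
    have e : (z ++ [false]).flatMap (spaceMor (k + 1)) =
        (z.flatMap (spaceMor (k + 1)) ++ zig k) ++ [true] ++ [false] := by
      have : zig (k + 1) = zig k ++ [true] ++ [false] := by
        simpa [zig, spaced] using (zig_append_zig k 0).symm
      simp [this]
    rw [e] at hw
    have := (suffix_of_concat_suffix (w := [false]) hw).2
    have := (suffix_of_concat_suffix (w := []) this).1
    simp at this
  · have e : (List.replicate (j + 1) [false, true]).flatten =
        (List.replicate j [false, true]).flatten ++ [false] ++ [true] := by
      simp [List.replicate_succ']
    rw [e, ← List.append_assoc] at hw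
    have := (suffix_of_concat_suffix (w := [false]) hw).1
    simp at this

/-! ### Right-special words of the images -/

theorem suffix_replicate_of_suffix {w X Y : List Bool} {k m : ℕ} (hkm : k ≠ m)
    (h1 : w <:+ X ++ true :: List.replicate k false)
    (h2 : w <:+ Y ++ true :: List.replicate m false) :
    w <:+ List.replicate (min k m) false := by
  wlog hlt : k < m generalizing k m X Y
  · rw [min_comm]
    exact this hkm.symm h2 h1 (by omega)
  rw [min_eq_left hlt.le]
  have e : List.replicate m false =
      List.replicate (m - k - 1) false ++ false :: List.replicate k false := by
    rw [← List.replicate_succ, List.replicate_append_replicate]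
    congr 1
    omega
  rw [e, ← List.cons_append, ← List.append_assoc] at h2
  exact suffix_of_common_suffix (by simp) h1 h2

theorem suffix_zig_of_suffix {w X Y : List Bool} {k m : ℕ} (hkm : k ≠ m)
    (h1 : w <:+ X ++ false :: zig k) (h2 : w <:+ Y ++ false :: zig m) :
    w <:+ zig (min k m) := by
  wlog hlt : k < m generalizing k m X Y
  · rw [min_comm]
    exact this hkm.symm h2 h1 (by omega)
  rw [min_eq_left hlt.le]
  have e : zig m = zig (m - k - 1) ++ true :: zig k := by
    rw [zig_append_zig]
    congr 1
    omega
  rw [e, ← List.cons_append, ← List.append_assoc] at h2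
  exact suffix_of_common_suffix (by simp) h1 h2

theorem zig_suffix_zig {k m : ℕ} (h : k ≤ m) : zig k <:+ zig m := by
  obtain ⟨d, rfl⟩ := Nat.exists_eq_add_of_le' h
  clear h
  induction d with
  | zero => simp
  | succ d ih =>
    rw [show d + 1 + k = d + k + 1 by omega, zig_succ]
    exact ih.trans ⟨[false, true], rfl⟩

theorem replicate_suffix_replicate {k m : ℕ} (h : k ≤ m) (a : Bool) :
    List.replicate k a <:+ List.replicate m a :=
  ⟨List.replicate (m - k) a, by rw [List.replicate_append_replicate]; congr 1; omega⟩

theorem powMor_rightSpecial {l : ℕ} (hl : 1 ≤ l) {P : Set (List Bool)} (hP : Factorial P)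
    (hext : LeftExt P) (h11 : [true, true] ∉ P) (h000 : [false, false, false] ∉ P)
    {w : List Bool} (hw : RightSpecial (image (powMor l) P) w) :
    w <:+ List.replicate (2 * l - 1) false ∨
      ∃ v, RightSpecial P v ∧ w <:+ v.flatMap (powMor l) := by
  obtain ⟨y₁, j, hy1, hj, k1⟩ := powMor_cut_false hP hw.1
  obtain ⟨y₂, hy2, k2⟩ := powMor_cut_true hP hw.2
  rcases Nat.eq_zero_or_pos j with rfl | hj0
  · exact Or.inr (exists_rightSpecial_of_suffix (powMor_endsInSelf hl) hP hy1 hy2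
      (by simpa using k1) k2)
  left
  obtain ⟨X, k, hk, hX⟩ : ∃ X k, (k = j ∨ k = l + j) ∧
      w <:+ X ++ true :: List.replicate k false := by
    obtain ⟨r, a₀, a, b, c, hr, hs⟩ := hext.exists_append hy1
    obtain ⟨s, hs⟩ := suffix_flatMap (powMor l) hs
    have k1' : w <:+ (r ++ [a₀, a, b, c]).flatMap (powMor l) ++ List.replicate j false :=
      k1.trans ⟨s, by rw [← hs]; simp⟩
    rcases c with _ | _
    · rcases b with _ | _
      · exact absurd (hP hr ⟨r ++ [a₀, a], [], by simp⟩) h000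
      · exact ⟨r.flatMap (powMor l) ++ powMor l a₀ ++ powMor l a, l + j, Or.inr rfl, by
          rw [List.replicate_add]; simpa using k1'⟩
    · exact ⟨r.flatMap (powMor l) ++ powMor l a₀ ++ powMor l a ++ powMor l b, j,
          Or.inl rfl, by simpa using k1'⟩
  obtain ⟨Y, m, hm, hY⟩ : ∃ Y m, (m = l ∨ m = l + l) ∧
      w <:+ Y ++ true :: List.replicate m false := by
    obtain ⟨r, a₀, a, b, c, hr, hs⟩ := hext.exists_append hy2
    have k2' := k2.trans (suffix_flatMap (powMor l) hs)
    rcases c with _ | _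
    · rcases b with _ | _
      · rcases a with _ | _
        · exact absurd (hP hr ⟨r ++ [a₀], [true], by simp⟩) h000
        · exact ⟨r.flatMap (powMor l) ++ powMor l a₀, l + l, Or.inr rfl, by
            rw [List.replicate_add]; simpa using k2'⟩
      · exact ⟨r.flatMap (powMor l) ++ powMor l a₀ ++ powMor l a, l, Or.inl rfl,
          by simpa using k2'⟩
    · exact absurd (hP hr ⟨r ++ [a₀, a, b], [], by simp⟩) h11
  exact (suffix_replicate_of_suffix (by omega) hX hY).trans
    (replicate_suffix_replicate (by omega) _)

theorem spaceMor_rightSpecial {g : ℕ} (hg : 1 ≤ g) {P : Set (List Bool)} (hP : Factorial P)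
    (hext : LeftExt P) (h11 : [true, true] ∉ P) (h101 : [true, false, true] ∉ P)
    {w : List Bool} (hw : RightSpecial (image (spaceMor g) P) w) :
    w <:+ zig (2 * g) ∨ ∃ v, RightSpecial P v ∧ w <:+ v.flatMap (spaceMor g) := by
  rcases List.eq_nil_or_concat w with rfl | ⟨w, c, rfl⟩
  · simp
  rw [List.concat_eq_append] at *
  rcases c with _ | _
  swap
  · exact absurd (image_factorial _ _ hw.2 ⟨w, [], by simp⟩) (spaceMor_no_true_true hP h11)
  obtain ⟨y₁, j, hy1, k1⟩ := spaceMor_cut_false hP hw.1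
  rcases j with _ | j
  swap
  · have e : (List.replicate (j + 1) [false, true]).flatten =
        (List.replicate j [false, true]).flatten ++ [false] ++ [true] := by
      simp [List.replicate_succ']
    rw [e, ← List.append_assoc] at k1
    have := (suffix_of_concat_suffix k1).1
    simp at this
  rw [List.replicate_zero, List.flatten_nil, List.append_nil] at k1
  rcases spaceMor_cut_true hP hw.2 with ⟨y₂, hy2, k2⟩ | ⟨y₂, j, hj, hy2, k2⟩
  · exact Or.inr (exists_rightSpecial_of_suffix (spaceMor_endsInSelf g) hP hy1 hy2 k1 k2)
  left
  set u := w ++ [false] with hu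
  obtain ⟨X, k, hk, hX⟩ : ∃ X k, (k = g ∨ k = g + g + 1) ∧ u <:+ X ++ false :: zig k := by
    obtain ⟨r, a, b, c, d, hr, hs⟩ := hext.exists_append hy1
    have k1' := k1.trans (suffix_flatMap (spaceMor g) hs)
    rcases d with _ | _
    · rcases c with _ | _
      · exact ⟨r.flatMap (spaceMor g) ++ spaceMor g a ++ spaceMor g b ++
          (List.replicate g [false, true]).flatten, g, Or.inl rfl, by simpa [zig, spaced] using k1'⟩
      rcases b with _ | _
      · rcases a with _ | _
        · refine ⟨r.flatMap (spaceMor g) ++ (List.replicate g [false, true]).flatten, g + g + 1,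
            Or.inr rfl, ?_⟩
          rw [← zig_append_zig]
          simpa [zig, spaced] using k1'
        · exact absurd (hP hr ⟨r, [false, false], by simp⟩) h101
      · exact absurd (hP hr ⟨r ++ [a], [false, false], by simp⟩) h11
    · obtain ⟨z, hz⟩ := (spaceMor_endsInSelf g).concat_mem k1'
      have := congrArg List.getLast? hz
      simp at this
  obtain ⟨Y, m, hm, hY⟩ : ∃ Y m, (m = j ∨ m = g + j + 1) ∧ u <:+ Y ++ false :: zig m := by
    obtain ⟨r, a, b, c, d, hr, hs⟩ := hext.exists_append hy2
    obtain ⟨s, hs⟩ := suffix_flatMap (spaceMor g) hs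
    have k2' : u <:+ (r ++ [a, b, c, d]).flatMap (spaceMor g) ++ zig j :=
      k2.trans ⟨s, by rw [← hs]; simp⟩
    rcases d with _ | _
    · exact ⟨r.flatMap (spaceMor g) ++ spaceMor g a ++ spaceMor g b ++ spaceMor g c ++
          (List.replicate g [false, true]).flatten, j, Or.inl rfl, by simpa [zig, spaced] using k2'⟩
    · rcases c with _ | _
      · rcases b with _ | _
        · refine ⟨r.flatMap (spaceMor g) ++ spaceMor g a ++
            (List.replicate g [false, true]).flatten, g + j + 1, Or.inr rfl, ?_⟩
          rw [← zig_append_zig]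
          simpa [zig, spaced] using k2'
        · exact absurd (hP hr ⟨r ++ [a], [false], by simp⟩) h101
      · exact absurd (hP hr ⟨r ++ [a, b], [false], by simp⟩) h11
  exact (suffix_zig_of_suffix (by omega) hX hY).trans (zig_suffix_zig (by omega))

/-! ### The words `B n` -/

section words

variable (L γ : ℕ → ℕ)

/-- The word `(B n 1) ^ (γ n) B n`, of which `B (n + 1)` is a power. -/
def block (n : ℕ) : List Bool :=
  spaced (Cseq L γ n) (γ n)

/-- The right-special word `(B n 1) ^ (2 * γ n) B n`. -/
def longRun (n : ℕ) : List Bool :=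
  spaced (Cseq L γ n) (2 * γ n)

/-- The right-special word `((B n 1) ^ (γ n) B n) ^ (2 * L n - 1)`. -/
def longPow (n : ℕ) : List Bool :=
  (List.replicate (2 * L n - 1) (block L γ n)).flatten

/-- The language as a set. -/
def lang : Set (List Bool) :=
  {w | InLangC L γ w}

/-- The composite morphism carrying the words of the shifted sequence to those of the sequence. -/
def mor (l g : ℕ) (y : List Bool) : List Bool :=
  (y.flatMap (powMor l)).flatMap (spaceMor g)

end words

section

variable {L γ : ℕ → ℕ}

theorem succ_eq {n : ℕ} (hn : 1 ≤ n) :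
    Cseq L γ (n + 1) = (List.replicate (L n) (block L γ n)).flatten := by
  obtain ⟨k, rfl⟩ := Nat.exists_eq_add_of_le' hn
  rfl

theorem flatten_replicate_flatMap (k : ℕ) (w : List Bool) (f : Bool → List Bool) :
    (List.replicate k w).flatten.flatMap f = (List.replicate k (w.flatMap f)).flatten := by
  induction k with
  | zero => simp
  | succ k ih => simp [List.replicate_succ, ih]

theorem mor_append (l g : ℕ) (y z : List Bool) : mor l g (y ++ z) = mor l g y ++ mor l g z := by
  simp [mor]

theorem mor_suffix (l g : ℕ) {y z : List Bool} (h : y <:+ z) : mor l g y <:+ mor l g z :=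
  suffix_flatMap _ (suffix_flatMap _ h)

theorem mor_spaced (l g : ℕ) (w : List Bool) (k : ℕ) :
    mor l g (spaced w k) = spaced (mor l g w) k := by
  rw [mor, spaced_flatMap _ _ rfl, spaced_flatMap _ _ rfl, mor]

theorem mor_flatten_replicate (l g : ℕ) (w : List Bool) (k : ℕ) :
    mor l g (List.replicate k w).flatten = (List.replicate k (mor l g w)).flatten := by
  rw [mor, flatten_replicate_flatMap, flatten_replicate_flatMap, mor]

theorem replicate_false_flatMap_spaceMor (g k : ℕ) :
    (List.replicate k false).flatMap (spaceMor g) = (List.replicate k (zig g)).flatten := by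
  induction k with
  | zero => simp
  | succ k ih => simp [List.replicate_succ, ih]

theorem mor_singleton_false : mor (L 1) (γ 1) [false] = Cseq L γ 2 := by
  rw [mor, List.flatMap_singleton, powMor_false, replicate_false_flatMap_spaceMor]
  rfl

theorem mor_shift {n : ℕ} (hn : 1 ≤ n) :
    mor (L 1) (γ 1) (Cseq (fun k => L (k + 1)) (fun k => γ (k + 1)) n) = Cseq L γ (n + 1) := by
  induction n, hn using Nat.le_induction with
  | base => exact mor_singleton_false
  | succ n hn ih =>
    rw [succ_eq hn, mor_flatten_replicate, block, mor_spaced, ih, succ_eq (n := n + 1) (by omega)]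
    rfl

theorem mor_shift_longRun {n : ℕ} (hn : 1 ≤ n) :
    mor (L 1) (γ 1) (longRun (fun k => L (k + 1)) (fun k => γ (k + 1)) n) =
      longRun L γ (n + 1) := by
  rw [longRun, mor_spaced, mor_shift hn, longRun]

theorem mor_shift_longPow {n : ℕ} (hn : 1 ≤ n) :
    mor (L 1) (γ 1) (longPow (fun k => L (k + 1)) (fun k => γ (k + 1)) n) =
      longPow L γ (n + 1) := by
  rw [longPow, mor_flatten_replicate, block, mor_spaced, mor_shift hn, longPow, block]

theorem exists_head (hL : ∀ n, 1 ≤ n → 2 ≤ L n) (n : ℕ) : ∃ e, Cseq L γ n = false :: e := by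
  have key : ∀ n, ∃ e, Cseq L γ (n + 1) = false :: e := by
    intro n
    induction n with
    | zero => exact ⟨[], rfl⟩
    | succ n ih =>
      obtain ⟨e, he⟩ := ih
      obtain ⟨k, hk⟩ := Nat.exists_eq_add_of_le' (hL (n + 1) (by omega))
      rw [succ_eq (by omega), hk, List.replicate_succ, List.flatten_cons, block, he]
      rcases γ (n + 1) with _ | m
      · exact ⟨_, by simp [spaced]; rfl⟩
      · rw [spaced_succ]; exact ⟨_, rfl⟩
  rcases n with _ | n
  · exact ⟨[], rfl⟩
  · exact key n

theorem suffix_block (n : ℕ) : Cseq L γ n <:+ block L γ n :=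
  List.suffix_append _ _

theorem suffix_longRun (n : ℕ) : Cseq L γ n <:+ longRun L γ n :=
  List.suffix_append _ _

theorem two_block_suffix_succ (hL : ∀ n, 1 ≤ n → 2 ≤ L n) {n : ℕ} (hn : 1 ≤ n) :
    block L γ n ++ block L γ n <:+ Cseq L γ (n + 1) := by
  obtain ⟨k, hk⟩ := Nat.exists_eq_add_of_le' (hL n hn)
  rw [succ_eq hn, hk, List.replicate_succ', List.replicate_succ']
  exact ⟨(List.replicate k (block L γ n)).flatten, by simp⟩

theorem two_block_prefix_succ (hL : ∀ n, 1 ≤ n → 2 ≤ L n) {n : ℕ} (hn : 1 ≤ n) :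
    block L γ n ++ block L γ n <+: Cseq L γ (n + 1) := by
  obtain ⟨k, hk⟩ := Nat.exists_eq_add_of_le' (hL n hn)
  rw [succ_eq hn, hk, List.replicate_succ, List.replicate_succ]
  exact ⟨(List.replicate k (block L γ n)).flatten, by simp⟩

theorem block_suffix_succ (hL : ∀ n, 1 ≤ n → 2 ≤ L n) {n : ℕ} (hn : 1 ≤ n) :
    block L γ n <:+ Cseq L γ (n + 1) :=
  (List.suffix_append _ _).trans (two_block_suffix_succ hL hn)

theorem suffix_of_le (hL : ∀ n, 1 ≤ n → 2 ≤ L n) {m n : ℕ} (hm : 1 ≤ m) (h : m ≤ n) :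
    Cseq L γ m <:+ Cseq L γ n := by
  induction n, h using Nat.le_induction with
  | base => simp
  | succ n hn ih =>
    exact ih.trans ((suffix_block n).trans (block_suffix_succ hL (by omega)))

theorem exists_last (hL : ∀ n, 1 ≤ n → 2 ≤ L n) {n : ℕ} (hn : 1 ≤ n) :
    ∃ e, Cseq L γ n = e ++ [false] := by
  obtain ⟨e, he⟩ := suffix_of_le (γ := γ) hL le_rfl hn
  exact ⟨e, he.symm⟩

theorem block_exists_last (hL : ∀ n, 1 ≤ n → 2 ≤ L n) {n : ℕ} (hn : 1 ≤ n) :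
    ∃ e, block L γ n = e ++ [false] := by
  obtain ⟨e, he⟩ := exists_last (γ := γ) hL hn
  rw [block, spaced, he, ← List.append_assoc]
  exact ⟨_, rfl⟩

theorem length_succ {n : ℕ} (hn : 1 ≤ n) :
    (Cseq L γ (n + 1)).length = L n * (block L γ n).length := by
  rw [succ_eq hn]; simp

theorem length_block (n : ℕ) :
    (block L γ n).length = (γ n + 1) * (Cseq L γ n).length + γ n :=
  length_spaced _ _

theorem length_longRun (n : ℕ) :
    (longRun L γ n).length = (2 * γ n + 1) * (Cseq L γ n).length + 2 * γ n :=
  length_spaced _ _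

theorem length_longPow (n : ℕ) :
    (longPow L γ n).length = (2 * L n - 1) * (block L γ n).length := by
  simp [longPow]

theorem length_longRun_le (hL : ∀ n, 1 ≤ n → 2 ≤ L n) {n : ℕ} (hn : 1 ≤ n) :
    (longRun L γ n).length ≤ (Cseq L γ (n + 1)).length := by
  rw [length_succ hn, length_longRun, length_block]
  have := Nat.mul_le_mul_right ((γ n + 1) * (Cseq L γ n).length + γ n) (hL n hn)
  nlinarith

theorem length_longPow_le {n : ℕ} (hn : 1 ≤ n) :
    (longPow L γ n).length ≤ 2 * (Cseq L γ (n + 1)).length := by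
  rw [length_succ hn, length_longPow, ← Nat.mul_assoc]
  exact Nat.mul_le_mul_right _ (by omega)

theorem two_mul_length_le (hL : ∀ n, 1 ≤ n → 2 ≤ L n) {n : ℕ} (hn : 1 ≤ n) :
    2 * (Cseq L γ n).length ≤ (Cseq L γ (n + 1)).length := by
  rw [length_succ hn]
  exact Nat.mul_le_mul (hL n hn) (suffix_block n).length_le

/-! ### The language -/

theorem lang_factorial : Factorial (lang L γ) :=
  fun _ _ ⟨n, hn⟩ hv => ⟨n, hv.trans hn⟩

theorem exists_infix_of_mem {w : List Bool} (hw : w ∈ lang L γ) :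
    ∃ n, 1 ≤ n ∧ w <:+: Cseq L γ n := by
  obtain ⟨_ | n, hn⟩ := hw
  · exact ⟨1, le_rfl, hn⟩
  · exact ⟨n + 1, by omega, hn⟩

theorem double_spaced_mem (hL : ∀ n, 1 ≤ n → 2 ≤ L n) (hγ : ∀ n, 1 ≤ n → 2 ≤ γ n) {n : ℕ}
    (hn : 1 ≤ n) : Cseq L γ n ++ (Cseq L γ n ++ true :: Cseq L γ n) ∈ lang L γ := by
  refine ⟨n + 1, List.IsInfix.trans ?_ (two_block_suffix_succ hL hn).isInfix⟩
  obtain ⟨s, hs⟩ := suffix_block (L := L) (γ := γ) n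
  obtain ⟨k, hk⟩ := Nat.exists_eq_add_of_le' (hγ n hn)
  refine ⟨s, true :: spaced (Cseq L γ n) k, ?_⟩
  have e : block L γ n =
      Cseq L γ n ++ true :: (Cseq L γ n ++ true :: spaced (Cseq L γ n) k) := by
    rw [block, hk, spaced_succ, spaced_succ]
  conv_rhs => rw [← hs, List.append_assoc, hs, e]
  simp

theorem spaced_double_mem (hL : ∀ n, 1 ≤ n → 2 ≤ L n) (hγ : ∀ n, 1 ≤ n → 2 ≤ γ n) {n : ℕ}
    (hn : 1 ≤ n) : Cseq L γ n ++ true :: (Cseq L γ n ++ Cseq L γ n) ∈ lang L γ := by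
  refine ⟨n + 1, List.IsInfix.trans ?_ (two_block_suffix_succ hL hn).isInfix⟩
  obtain ⟨k, hk⟩ := Nat.exists_eq_add_of_le' (hγ n hn)
  have e : block L γ n = Cseq L γ n ++ true :: spaced (Cseq L γ n) (k + 1) := by
    rw [block, hk, spaced_succ]
  have e' : block L γ n = spaced (Cseq L γ n) k ++ true :: (Cseq L γ n ++ true :: Cseq L γ n) := by
    have : Cseq L γ n ++ true :: Cseq L γ n = spaced (Cseq L γ n) 1 := by simp [spaced]
    rw [this, spaced_append_spaced, block, hk]
  refine ⟨spaced (Cseq L γ n) k ++ [true], true :: spaced (Cseq L γ n) (k + 1), ?_⟩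
  calc _ = (spaced (Cseq L γ n) k ++ true :: (Cseq L γ n ++ true :: Cseq L γ n)) ++
        (Cseq L γ n ++ true :: spaced (Cseq L γ n) (k + 1)) := by simp
    _ = _ := by rw [← e, ← e']

theorem lang_leftExt (hL : ∀ n, 1 ≤ n → 2 ≤ L n) (hγ : ∀ n, 1 ≤ n → 2 ≤ γ n) :
    LeftExt (lang L γ) := by
  intro w hw
  obtain ⟨n, hn, s, t, h⟩ := exists_infix_of_mem hw
  rcases List.eq_nil_or_concat (Cseq L γ n ++ s) with h' | ⟨r, b, h'⟩
  · obtain ⟨e, he⟩ := exists_head (γ := γ) hL n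
    simp [he] at h'
  · refine ⟨b, lang_factorial (double_spaced_mem hL hγ hn) ⟨r, t ++ true :: Cseq L γ n, ?_⟩⟩
    rw [List.concat_eq_append] at h'
    calc _ = (r ++ [b]) ++ (w ++ t) ++ true :: Cseq L γ n := by simp
      _ = _ := by rw [← h', ← h]; simp

theorem lang_rightExt (hL : ∀ n, 1 ≤ n → 2 ≤ L n) (hγ : ∀ n, 1 ≤ n → 2 ≤ γ n) {w : List Bool}
    (hw : w ∈ lang L γ) : ∃ a, w ++ [a] ∈ lang L γ := by
  obtain ⟨n, hn, s, t, h⟩ := exists_infix_of_mem hw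
  have hm := spaced_double_mem hL hγ hn
  have e : ∃ a t', t ++ true :: (Cseq L γ n ++ Cseq L γ n) = a :: t' := by
    rcases t with _ | ⟨a, t⟩
    · exact ⟨_, _, rfl⟩
    · exact ⟨_, _, rfl⟩
  obtain ⟨a, t', e⟩ := e
  refine ⟨a, lang_factorial hm ⟨s, t', ?_⟩⟩
  calc s ++ (w ++ [a]) ++ t' = (s ++ w) ++ (a :: t') := by simp
    _ = (s ++ w ++ t) ++ true :: (Cseq L γ n ++ Cseq L γ n) := by rw [← e]; simp
    _ = _ := by rw [h]

theorem lang_subset_image (hL : ∀ n, 1 ≤ n → 2 ≤ L n) :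
    lang L γ ⊆ image (spaceMor (γ 1)) (image (powMor (L 1))
      (lang (fun k => L (k + 1)) (fun k => γ (k + 1)))) := by
  intro w hw
  obtain ⟨n, hn, h⟩ := exists_infix_of_mem hw
  have h2 := h.trans (suffix_of_le (γ := γ) hL hn (Nat.le_succ n)).isInfix
  rw [Nat.succ_eq_add_one, ← mor_shift hn] at h2
  exact ⟨_, ⟨_, ⟨n, List.infix_rfl⟩, List.infix_rfl⟩, h2⟩

theorem no_true_true_infix :
    ∀ (n : ℕ) {L γ : ℕ → ℕ}, (∀ n, 1 ≤ n → 2 ≤ L n) → ¬ [true, true] <:+: Cseq L γ (n + 1) := by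
  intro n
  induction n with
  | zero =>
    intro L γ _ h
    simpa [Cseq] using h.length_le
  | succ n ih =>
    intro L γ hL h
    rw [← mor_shift (by omega)] at h
    set P : Set (List Bool) :=
      {w | w <:+: Cseq (fun k => L (k + 1)) (fun k => γ (k + 1)) (n + 1)} with hPdef
    have hP : Factorial P := fun v w hw hv => hv.trans hw
    refine spaceMor_no_true_true (g := γ 1) (image_factorial _ _)
      (powMor_no_true_true (l := L 1) (by have := hL 1 le_rfl; omega) hP
        (ih fun k _ => hL (k + 1) (by omega))) ?_
    exact ⟨_, ⟨_, List.infix_rfl, List.infix_rfl⟩, h⟩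

theorem lang_no_true_true (hL : ∀ n, 1 ≤ n → 2 ≤ L n) : [true, true] ∉ lang L γ := by
  intro h
  obtain ⟨n, hn, h⟩ := exists_infix_of_mem h
  obtain ⟨k, rfl⟩ := Nat.exists_eq_add_of_le' hn
  exact no_true_true_infix k hL h

theorem lang_no_false_pow_three (hL : ∀ n, 1 ≤ n → 2 ≤ L n) (hγ : ∀ n, 1 ≤ n → 2 ≤ γ n) :
    [false, false, false] ∉ lang L γ := fun h =>
  spaceMor_no_false_pow_three (by have := hγ 1 le_rfl; omega) (image_factorial _ _)
    (lang_subset_image hL h)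

/-! ### Classification of the right-special words -/

theorem RightSpecial.eq_nil_or_concat_false (hL : ∀ n, 1 ≤ n → 2 ≤ L n) {w : List Bool}
    (hw : RightSpecial (lang L γ) w) : w = [] ∨ ∃ v, w = v ++ [false] := by
  rcases List.eq_nil_or_concat w with h | ⟨v, _ | _, rfl⟩
  · exact Or.inl h
  · exact Or.inr ⟨v, by simp⟩
  · exact absurd (lang_factorial hw.2 ⟨v, [], by simp⟩) (lang_no_true_true hL)

theorem EndsInSelf.length_le {f : Bool → List Bool} (hf : EndsInSelf f) (y : List Bool) :
    y.length ≤ (y.flatMap f).length := by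
  induction y with
  | nil => simp
  | cons a y ih =>
    have := List.length_pos_of_ne_nil (hf.ne_nil a)
    simp only [List.flatMap_cons, List.length_append, List.length_cons]
    omega

theorem exists_preimage_of_rightSpecial (hL : ∀ n, 1 ≤ n → 2 ≤ L n) (hγ : ∀ n, 1 ≤ n → 2 ≤ γ n)
    {w : List Bool} (hw : RightSpecial (lang L γ) w) :
    w <:+ longRun L γ 1 ∨ w <:+ longPow L γ 1 ∨
      ∃ v, RightSpecial (lang (fun k => L (k + 1)) (fun k => γ (k + 1))) v ∧
        w <:+ mor (L 1) (γ 1) v := by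
  have hl := hL 1 le_rfl
  have hg := hγ 1 le_rfl
  have hL' : ∀ n, 1 ≤ n → 2 ≤ L (n + 1) := fun k _ => hL (k + 1) (by omega)
  have hγ' : ∀ n, 1 ≤ n → 2 ≤ γ (n + 1) := fun k _ => hγ (k + 1) (by omega)
  have h11 := lang_no_true_true (γ := fun k => γ (k + 1)) hL'
  have hext := lang_leftExt hL' hγ'
  rcases spaceMor_rightSpecial (by omega) (image_factorial _ _)
      (image_leftExt (powMor_endsInSelf (by omega)).ne_nil hext)
      (powMor_no_true_true (by omega) lang_factorial h11)
      (powMor_no_true_false_true hl lang_factorial)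
      ⟨lang_subset_image hL hw.1, lang_subset_image hL hw.2⟩ with h | ⟨v, hv, h⟩
  · exact Or.inl h
  rcases powMor_rightSpecial (by omega) lang_factorial hext h11
    (lang_no_false_pow_three hL' hγ') hv with h' | ⟨u, hu, h'⟩
  · refine Or.inr (Or.inl (h.trans ?_))
    have := suffix_flatMap (spaceMor (γ 1)) h'
    rwa [replicate_false_flatMap_spaceMor] at this
  · exact Or.inr (Or.inr ⟨u, hu, h.trans (suffix_flatMap _ h')⟩)

theorem rightSpecial_cases : ∀ (N : ℕ) {L γ : ℕ → ℕ}, (∀ n, 1 ≤ n → 2 ≤ L n) →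
    (∀ n, 1 ≤ n → 2 ≤ γ n) → ∀ {w : List Bool}, w.length ≤ N → RightSpecial (lang L γ) w →
    ∃ n, 1 ≤ n ∧ (w <:+ Cseq L γ n ∨ w <:+ longRun L γ n ∨ w <:+ longPow L γ n) := by
  intro N
  induction N with
  | zero =>
    intro L γ _ _ w hw _
    obtain rfl := List.length_eq_zero_iff.mp (Nat.le_zero.mp hw)
    exact ⟨1, le_rfl, Or.inl List.nil_suffix⟩
  | succ N ih =>
    intro L γ hL hγ w hwN hw
    rcases exists_preimage_of_rightSpecial hL hγ hw with h | h | ⟨v, hv, h⟩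
    · exact ⟨1, le_rfl, Or.inr (Or.inl h)⟩
    · exact ⟨1, le_rfl, Or.inr (Or.inr h)⟩
    have hL' : ∀ n, 1 ≤ n → 2 ≤ L (n + 1) := fun k _ => hL (k + 1) (by omega)
    have hγ' : ∀ n, 1 ≤ n → 2 ≤ γ (n + 1) := fun k _ => hγ (k + 1) (by omega)
    have h2 : 2 * (Cseq L γ 1).length ≤ (Cseq L γ 2).length := two_mul_length_le hL le_rfl
    have h1 : (Cseq L γ 1).length = 1 := rfl
    have hlen : ∀ y, y.length ≤ (mor (L 1) (γ 1) y).length := fun y =>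
      ((powMor_endsInSelf (by have := hL 1 le_rfl; omega)).length_le y).trans
        ((spaceMor_endsInSelf _).length_le _)
    have hconcat : ∀ z, mor (L 1) (γ 1) (z ++ [false]) = mor (L 1) (γ 1) z ++ Cseq L γ 2 :=
      fun z => by rw [mor_append, mor_singleton_false]
    by_cases hw2 : w.length ≤ (Cseq L γ 2).length
    · refine ⟨2, by omega, Or.inl ?_⟩
      rcases hv.eq_nil_or_concat_false hL' with rfl | ⟨z, rfl⟩
      · rw [List.suffix_nil.mp h]
        exact List.nil_suffix
      · rw [hconcat] at h
        exact List.suffix_of_suffix_length_le h (List.suffix_append _ _) hw2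
    obtain ⟨v, hv, h, hvN⟩ : ∃ v, RightSpecial (lang (fun k => L (k + 1)) (fun k => γ (k + 1))) v ∧
        w <:+ mor (L 1) (γ 1) v ∧ v.length ≤ N := by
      by_cases hc : v.length ≤ N
      · exact ⟨v, hv, h, hc⟩
      have hs := List.drop_suffix (v.length - N) v
      have hd : (v.drop (v.length - N)).length = N := by simp; omega
      have hr := hv.suffix lang_factorial hs
      refine ⟨_, hr, List.suffix_of_suffix_length_le h (mor_suffix _ _ hs) ?_, hd.le⟩
      rcases hr.eq_nil_or_concat_false hL' with h0 | ⟨z, hz⟩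
      · rw [h0, List.length_nil] at hd
        omega
      · have := hlen z
        rw [hz] at hd ⊢
        rw [hconcat]
        simp only [List.length_append, List.length_singleton] at hd ⊢
        omega
    obtain ⟨n, hn, h'⟩ := ih hL' hγ' hvN hv
    refine ⟨n + 1, by omega, ?_⟩
    rw [← mor_shift hn, ← mor_shift_longRun hn, ← mor_shift_longPow hn]
    exact h'.imp (fun h' => h.trans (mor_suffix _ _ h'))
      (fun h' => h'.imp (fun h' => h.trans (mor_suffix _ _ h')) fun h' => h.trans (mor_suffix _ _ h'))

theorem rightSpecial_of_mem {X Y w : List Bool} (hL : ∀ n, 1 ≤ n → 2 ≤ L n) {n : ℕ}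
    (h0 : X ++ Cseq L γ n ∈ lang L γ) (h1 : Y ++ [true] ∈ lang L γ) (hX : w <:+ X)
    (hY : w <:+ Y) : RightSpecial (lang L γ) w := by
  obtain ⟨s, rfl⟩ := hX
  obtain ⟨t, rfl⟩ := hY
  obtain ⟨e, he⟩ := exists_head (γ := γ) hL n
  exact ⟨lang_factorial h0 ⟨s, e, by simp [he]⟩, lang_factorial h1 ⟨t, [], by simp⟩⟩

theorem rightSpecial_of_suffix (hL : ∀ n, 1 ≤ n → 2 ≤ L n) (hγ : ∀ n, 1 ≤ n → 2 ≤ γ n) {n : ℕ}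
    (hn : 1 ≤ n) {w : List Bool} (hw : w <:+ Cseq L γ n) : RightSpecial (lang L γ) w :=
  rightSpecial_of_mem hL (n := n) (X := Cseq L γ n) (Y := Cseq L γ n)
    (lang_factorial (double_spaced_mem hL hγ hn) ⟨[], true :: Cseq L γ n, by simp⟩)
    (lang_factorial (double_spaced_mem hL hγ hn) ⟨Cseq L γ n, Cseq L γ n, by simp⟩) hw hw

theorem rightSpecial_of_suffix_longRun (hL : ∀ n, 1 ≤ n → 2 ≤ L n) (hγ : ∀ n, 1 ≤ n → 2 ≤ γ n)
    {n : ℕ} (hn : 1 ≤ n) {w : List Bool} (hw : w <:+ longRun L γ n) :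
    RightSpecial (lang L γ) w := by
  have hbb : block L γ n ++ true :: block L γ n = spaced (Cseq L γ n) (2 * γ n + 1) := by
    rw [block, spaced_append_spaced, two_mul]
  have hmem : block L γ n ++ true :: (block L γ n ++ block L γ n) ∈ lang L γ := by
    obtain ⟨s, hs⟩ := block_suffix_succ (γ := γ) hL hn
    obtain ⟨t, ht⟩ := two_block_prefix_succ (γ := γ) hL hn
    refine lang_factorial (double_spaced_mem hL hγ (n := n + 1) (by omega))
      ⟨Cseq L γ (n + 1) ++ s, t, ?_⟩
    calc _ = Cseq L γ (n + 1) ++ ((s ++ block L γ n) ++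
          true :: (block L γ n ++ block L γ n ++ t)) := by simp
      _ = _ := by rw [hs, ht]
  obtain ⟨s, hs⟩ := suffix_block (L := L) (γ := γ) n
  have hb : ∃ r, block L γ n = Cseq L γ n ++ r := by
    obtain ⟨k, hk⟩ := Nat.exists_eq_add_of_le' (hγ n hn)
    exact ⟨_, by rw [block, hk, spaced_succ]⟩
  obtain ⟨r, hr⟩ := hb
  have e0 : spaced (Cseq L γ n) (2 * γ n + 1) = (Cseq L γ n ++ [true]) ++ longRun L γ n := by
    rw [spaced_succ, longRun]
    simp
  have e1 : spaced (Cseq L γ n) (2 * γ n + 1) = longRun L γ n ++ true :: Cseq L γ n := by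
    rw [longRun, ← spaced_append_spaced _ _ 0]
    simp [spaced]
  refine rightSpecial_of_mem hL (n := n) (X := longRun L γ n) (Y := longRun L γ n)
    (lang_factorial hmem ⟨Cseq L γ n ++ [true], r, ?_⟩)
    (lang_factorial hmem ⟨[], Cseq L γ n ++ block L γ n, ?_⟩) hw hw
  · calc _ = ((Cseq L γ n ++ [true]) ++ longRun L γ n) ++ (Cseq L γ n ++ r) := by simp
      _ = _ := by rw [← e0, ← hbb, ← hr]; simp
  · calc _ = (longRun L γ n ++ true :: Cseq L γ n) ++ block L γ n := by simp
      _ = _ := by rw [← e1, ← hbb]; simp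

theorem longPow_append_block {n : ℕ} (hL : ∀ n, 1 ≤ n → 2 ≤ L n) (hn : 1 ≤ n) :
    longPow L γ n ++ block L γ n = Cseq L γ (n + 1) ++ Cseq L γ (n + 1) ∧
      block L γ n ++ longPow L γ n = Cseq L γ (n + 1) ++ Cseq L γ (n + 1) := by
  have e : Cseq L γ (n + 1) ++ Cseq L γ (n + 1) =
      (List.replicate (2 * L n - 1 + 1) (block L γ n)).flatten := by
    rw [succ_eq hn, ← List.flatten_append, List.replicate_append_replicate]
    congr 2
    have := hL n hn
    omega
  rw [e]
  constructor
  · rw [List.replicate_succ', List.flatten_append]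
    simp [longPow]
  · rw [List.replicate_succ, List.flatten_cons, longPow]

theorem rightSpecial_of_suffix_longPow (hL : ∀ n, 1 ≤ n → 2 ≤ L n) (hγ : ∀ n, 1 ≤ n → 2 ≤ γ n)
    {n : ℕ} (hn : 1 ≤ n) {w : List Bool} (hw : w <:+ longPow L γ n) :
    RightSpecial (lang L γ) w := by
  obtain ⟨h0, h1⟩ := longPow_append_block (γ := γ) hL hn
  have hmem := double_spaced_mem hL hγ (n := n + 1) (by omega)
  obtain ⟨k, hk⟩ := Nat.exists_eq_add_of_le' (hγ n hn)
  refine rightSpecial_of_mem hL (n := n) (X := longPow L γ n)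
    (Y := Cseq L γ (n + 1) ++ Cseq L γ (n + 1))
    (lang_factorial hmem ⟨[], true :: spaced (Cseq L γ n) (k + 1) ++ true :: Cseq L γ (n + 1), ?_⟩)
    (lang_factorial hmem ⟨[], Cseq L γ (n + 1), by simp⟩) hw ?_
  · calc _ = longPow L γ n ++ (Cseq L γ n ++ true :: spaced (Cseq L γ n) (k + 1)) ++
          true :: Cseq L γ (n + 1) := by simp
      _ = longPow L γ n ++ block L γ n ++ true :: Cseq L γ (n + 1) := by
          rw [← spaced_succ, block, hk]
      _ = _ := by rw [h0]; simp
  · rw [← h1]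
    exact hw.trans (List.suffix_append _ _)

theorem succ_suffix_longPow (hL : ∀ n, 1 ≤ n → 2 ≤ L n) {n : ℕ} (hn : 1 ≤ n) :
    Cseq L γ (n + 1) <:+ longPow L γ n := by
  have h1 := (longPow_append_block (γ := γ) hL hn).2
  refine List.suffix_of_suffix_length_le (l₃ := Cseq L γ (n + 1) ++ Cseq L γ (n + 1))
    (List.suffix_append _ _) (h1 ▸ List.suffix_append _ _) ?_
  rw [length_succ hn, length_longPow]
  have := hL n hn
  exact Nat.mul_le_mul_right _ (by omega)

/-- The right-special words of length at most `h (n + 1)`, provided the length exceeds `h n`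
unless `n = 1`. -/
theorem rightSpecial_iff (hL : ∀ n, 1 ≤ n → 2 ≤ L n) (hγ : ∀ n, 1 ≤ n → 2 ≤ γ n) {n : ℕ}
    (hn : 1 ≤ n) {w : List Bool} (hlow : 2 ≤ n → (Cseq L γ n).length < w.length)
    (hup : w.length ≤ (Cseq L γ (n + 1)).length) :
    RightSpecial (lang L γ) w ↔
      w <:+ Cseq L γ (n + 1) ∨ w <:+ longRun L γ n ∨ (2 ≤ n ∧ w <:+ longPow L γ (n - 1)) := by
  constructor
  · intro hw
    have hB : ∀ m, 1 ≤ m → w <:+ Cseq L γ m → w <:+ Cseq L γ (n + 1) := by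
      intro m hm h
      rcases Nat.le_total m (n + 1) with hle | hle
      · exact h.trans (suffix_of_le hL hm hle)
      · exact List.suffix_of_suffix_length_le h (suffix_of_le hL (by omega) hle) hup
    have hmono : ∀ a b, 1 ≤ a → a ≤ b → (Cseq L γ a).length ≤ (Cseq L γ b).length :=
      fun a b ha hab => (suffix_of_le hL ha hab).length_le
    obtain ⟨m, hm, h | h | h⟩ := rightSpecial_cases w.length hL hγ le_rfl hw
    · exact Or.inl (hB m hm h)
    · rcases lt_trichotomy m n with hlt | rfl | hlt
      · have := hlow (by omega)
        have := h.length_le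
        have := length_longRun_le (γ := γ) hL hm
        have := hmono (m + 1) n (by omega) (by omega)
        omega
      · exact Or.inr (Or.inl h)
      · exact Or.inl (hB m hm (List.suffix_of_suffix_length_le h (suffix_longRun m)
          (hup.trans (hmono _ _ (by omega) (by omega)))))
    · rcases Nat.lt_or_ge m n with hlt | hge
      · rcases Nat.lt_or_ge (m + 1) n with hlt' | hge
        · have := hlow (by omega)
          have := h.length_le
          have := length_longPow_le (L := L) (γ := γ) hm
          have := two_mul_length_le (γ := γ) hL (n := m + 1) (by omega)
          have := hmono (m + 1 + 1) n (by omega) (by omega)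
          omega
        · obtain rfl : n = m + 1 := by omega
          exact Or.inr (Or.inr ⟨by omega, h⟩)
      · exact Or.inl (hB (m + 1) (by omega) (List.suffix_of_suffix_length_le h
          (succ_suffix_longPow hL hm) (hup.trans (hmono _ _ (by omega) (by omega)))))
  · rintro (h | h | ⟨h2, h⟩)
    · exact rightSpecial_of_suffix hL hγ (by omega) h
    · exact rightSpecial_of_suffix_longRun hL hγ hn h
    · exact rightSpecial_of_suffix_longPow hL hγ (by omega) h

/-! ### Counting -/

theorem finite_setOf_length_and (q : ℕ) (p : List Bool → Prop) :
    {w : List Bool | w.length = q ∧ p w}.Finite :=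
  (List.finite_length_eq Bool q).subset fun _ h => h.1

theorem complexityC_succ (hL : ∀ n, 1 ≤ n → 2 ≤ L n) (hγ : ∀ n, 1 ≤ n → 2 ≤ γ n) (q : ℕ) :
    complexityC L γ (q + 1) = complexityC L γ q +
      {w : List Bool | w.length = q ∧ RightSpecial (lang L γ) w}.ncard := by
  let A (a : Bool) : Set (List Bool) := {w | w.length = q ∧ w ++ [a] ∈ lang L γ}
  have hA : ∀ a, (A a).Finite := fun a => finite_setOf_length_and q _
  have hinj : ∀ a : Bool, Function.Injective fun w : List Bool => w ++ [a] :=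
    fun a => List.append_left_injective [a]
  have e1 : {w : List Bool | w.length = q + 1 ∧ InLangC L γ w} =
      (fun w => w ++ [false]) '' A false ∪ (fun w => w ++ [true]) '' A true := by
    ext w
    constructor
    · rintro ⟨hl, hw⟩
      rcases List.eq_nil_or_concat w with rfl | ⟨v, _ | _, rfl⟩
      · simp at hl
      · exact Or.inl ⟨v, ⟨by simpa using hl, by simpa [lang] using hw⟩, by simp⟩
      · exact Or.inr ⟨v, ⟨by simpa using hl, by simpa [lang] using hw⟩, by simp⟩
    · rintro (⟨v, ⟨hl, hv⟩, rfl⟩ | ⟨v, ⟨hl, hv⟩, rfl⟩)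
      · exact ⟨by simp [hl], hv⟩
      · exact ⟨by simp [hl], hv⟩
  have e2 : {w : List Bool | w.length = q ∧ InLangC L γ w} = A false ∪ A true := by
    ext w
    constructor
    · rintro ⟨hl, hw⟩
      obtain ⟨_ | _, ha⟩ := lang_rightExt hL hγ hw
      · exact Or.inl ⟨hl, ha⟩
      · exact Or.inr ⟨hl, ha⟩
    · rintro (⟨hl, hv⟩ | ⟨hl, hv⟩)
      · exact ⟨hl, lang_factorial hv ⟨[], [false], by simp⟩⟩
      · exact ⟨hl, lang_factorial hv ⟨[], [true], by simp⟩⟩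
  have e3 : {w : List Bool | w.length = q ∧ RightSpecial (lang L γ) w} = A false ∩ A true := by
    ext w
    exact ⟨fun ⟨hl, h0, h1⟩ => ⟨⟨hl, h0⟩, hl, h1⟩, fun ⟨⟨hl, h0⟩, _, h1⟩ => ⟨hl, h0, h1⟩⟩
  rw [complexityC, complexityC, e1, e2, e3, Set.ncard_union_add_ncard_inter _ _ (hA _) (hA _),
    Set.ncard_union_eq _ ((hA _).image _) ((hA _).image _),
    Set.ncard_image_of_injective _ (hinj _), Set.ncard_image_of_injective _ (hinj _)]
  rw [Set.disjoint_left]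
  rintro _ ⟨v, -, rfl⟩ ⟨u, -, hu⟩
  simpa using (List.append_inj' hu rfl).2

theorem length_eq_and_suffix_iff {α : Type*} {q : ℕ} {w X : List α} (hX : q ≤ X.length) :
    w.length = q ∧ w <:+ X ↔ w = X.drop (X.length - q) := by
  constructor
  · rintro ⟨rfl, h⟩
    exact List.suffix_iff_eq_drop.mp h
  · rintro rfl
    exact ⟨by simp; omega, List.drop_suffix _ _⟩

theorem ncard_length_eq_and_suffix {α : Type*} {q : ℕ} {X : List α} (hX : q ≤ X.length) :
    {w : List α | w.length = q ∧ w <:+ X}.ncard = 1 := by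
  simp [length_eq_and_suffix_iff hX]

theorem ncard_length_eq_and_suffix_or {α : Type*} {q : ℕ} {X Y : List α} (hX : q ≤ X.length)
    (hY : q ≤ Y.length) (h : ∀ w, w.length = q → w <:+ X → ¬ w <:+ Y) :
    {w : List α | w.length = q ∧ (w <:+ X ∨ w <:+ Y)}.ncard = 2 := by
  simp only [and_or_left, length_eq_and_suffix_iff hX, length_eq_and_suffix_iff hY]
  refine Set.ncard_pair fun he => ?_
  obtain ⟨h1, h2⟩ := (length_eq_and_suffix_iff hX).mpr rfl
  exact h _ h1 h2 (he ▸ List.drop_suffix _ _)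

theorem longRun_eq {n : ℕ} (hγ : ∀ n, 1 ≤ n → 2 ≤ γ n) (hn : 1 ≤ n) :
    ∃ s, longRun L γ n = s ++ true :: block L γ n := by
  refine ⟨spaced (Cseq L γ n) (γ n - 1), ?_⟩
  rw [block, spaced_append_spaced, longRun]
  have := hγ n hn
  congr 1
  omega

theorem block_suffix_longRun {n : ℕ} (hγ : ∀ n, 1 ≤ n → 2 ≤ γ n) (hn : 1 ≤ n) :
    block L γ n <:+ longRun L γ n := by
  obtain ⟨s, hs⟩ := longRun_eq (L := L) hγ hn
  exact ⟨s ++ [true], by simp [hs]⟩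

theorem length_lt_of_longPow_lt (hL : ∀ n, 1 ≤ n → 2 ≤ L n) {n q : ℕ} (hn : 2 ≤ n)
    (h : (longPow L γ (n - 1)).length < q) : (Cseq L γ n).length < q := by
  have h' := (succ_suffix_longPow (γ := γ) hL (n := n - 1) (by omega)).length_le
  rw [Nat.sub_add_cancel (by omega)] at h'
  omega

theorem suffix_succ_of_suffix_longRun (hL : ∀ n, 1 ≤ n → 2 ≤ L n) (hγ : ∀ n, 1 ≤ n → 2 ≤ γ n)
    {n : ℕ} (hn : 1 ≤ n) {w : List Bool} (h : w <:+ longRun L γ n)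
    (hw : w.length ≤ (block L γ n).length) : w <:+ Cseq L γ (n + 1) :=
  (List.suffix_of_suffix_length_le h (block_suffix_longRun hγ hn) hw).trans
    (block_suffix_succ hL hn)

theorem complexityC_succ_eq_add_one (hL : ∀ n, 1 ≤ n → 2 ≤ L n) (hγ : ∀ n, 1 ≤ n → 2 ≤ γ n)
    {n q : ℕ} (hn : 1 ≤ n) (hlow : 2 ≤ n → (longPow L γ (n - 1)).length < q)
    (hmid : q ≤ (block L γ n).length ∨ (longRun L γ n).length < q)
    (hup : q ≤ (Cseq L γ (n + 1)).length) :
    complexityC L γ (q + 1) = complexityC L γ q + 1 := by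
  rw [complexityC_succ hL hγ, ← ncard_length_eq_and_suffix hup]
  congr 2
  ext w
  refine and_congr_right ?_
  rintro rfl
  rw [rightSpecial_iff hL hγ hn (fun h2 => length_lt_of_longPow_lt hL h2 (hlow h2)) hup]
  refine ⟨?_, Or.inl⟩
  rintro (h | h | ⟨h2, h⟩)
  · exact h
  · refine suffix_succ_of_suffix_longRun hL hγ hn h (hmid.resolve_right ?_)
    have := h.length_le
    omega
  · have := h.length_le
    have := hlow h2
    omega

theorem complexityC_succ_of_le_longRun (hL : ∀ n, 1 ≤ n → 2 ≤ L n) (hγ : ∀ n, 1 ≤ n → 2 ≤ γ n)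
    {n q : ℕ} (hn : 1 ≤ n) (hlow : 2 ≤ n → (longPow L γ (n - 1)).length < q)
    (hmid : (block L γ n).length < q) (hup : q ≤ (longRun L γ n).length) :
    complexityC L γ (q + 1) = complexityC L γ q + 2 := by
  have hup' := hup.trans (length_longRun_le hL hn)
  rw [complexityC_succ hL hγ, ← ncard_length_eq_and_suffix_or hup' hup]
  · congr 2
    ext w
    refine and_congr_right ?_
    rintro rfl
    rw [rightSpecial_iff hL hγ hn (fun h2 => length_lt_of_longPow_lt hL h2 (hlow h2)) hup']
    refine or_congr_right (or_iff_left ?_)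
    rintro ⟨h2, h⟩
    have := h.length_le
    have := hlow h2
    omega
  · rintro w rfl h1 h2
    obtain ⟨s, hs⟩ := longRun_eq (L := L) hγ hn
    obtain ⟨t, ht⟩ := two_block_suffix_succ (γ := γ) hL hn
    obtain ⟨e, he⟩ := block_exists_last (γ := γ) hL hn
    rw [hs] at h2
    have h1' : w <:+ (t ++ e) ++ false :: block L γ n := by
      have e' : (t ++ e) ++ false :: block L γ n = t ++ ((e ++ [false]) ++ block L γ n) := by simp
      rwa [e', ← he, ht]
    have := (suffix_of_common_suffix (by simp) h1' h2).length_le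
    omega

theorem complexityC_succ_of_le_longPow (hL : ∀ n, 1 ≤ n → 2 ≤ L n) (hγ : ∀ n, 1 ≤ n → 2 ≤ γ n)
    {n q : ℕ} (hn : 1 ≤ n) (hlow : (Cseq L γ (n + 1)).length < q)
    (hup : q ≤ (longPow L γ n).length) :
    complexityC L γ (q + 1) = complexityC L γ q + 2 := by
  have hup1 := hup.trans (length_longPow_le hn)
  have hblock : q ≤ (block L γ (n + 1)).length := by
    refine hup1.trans ?_
    rw [length_block]
    have := hγ (n + 1) (by omega)
    nlinarith
  have hup' := hup1.trans (two_mul_length_le hL (by omega))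
  rw [complexityC_succ hL hγ, ← ncard_length_eq_and_suffix_or hup' hup]
  · congr 2
    ext w
    refine and_congr_right ?_
    rintro rfl
    rw [rightSpecial_iff hL hγ (n := n + 1) (by omega) (fun _ => hlow) hup']
    constructor
    · rintro (h | h | ⟨-, h⟩)
      · exact Or.inl h
      · exact Or.inl (suffix_succ_of_suffix_longRun hL hγ (by omega) h hblock)
      · exact Or.inr h
    · exact Or.imp_right fun h => Or.inr ⟨by omega, h⟩
  · rintro w rfl h1 h2
    obtain ⟨s, hs⟩ := block_suffix_succ (γ := γ) hL (n := n + 1) (by omega)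
    obtain ⟨k, hk⟩ := Nat.exists_eq_add_of_le' (hγ (n + 1) (by omega))
    have hb : block L γ (n + 1) =
        spaced (Cseq L γ (n + 1)) (k + 1) ++ true :: Cseq L γ (n + 1) := by
      rw [block, hk, ← spaced_append_spaced _ _ 0]
      simp [spaced]
    rw [← hs, hb, ← List.append_assoc] at h1
    have hp : ∃ t, longPow L γ n = t ++ false :: Cseq L γ (n + 1) := by
      obtain ⟨m, hm⟩ := Nat.exists_eq_add_of_le' (hL n hn)
      obtain ⟨e, he⟩ := block_exists_last (γ := γ) hL hn
      refine ⟨(List.replicate m (block L γ n)).flatten ++ e, ?_⟩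
      have e' : 2 * L n - 1 = m + 1 + L n := by omega
      calc _ = (List.replicate m (block L γ n)).flatten ++ (block L γ n ++ Cseq L γ (n + 1)) := by
            rw [longPow, e', List.replicate_add, List.flatten_append, ← succ_eq hn,
              List.replicate_succ', List.flatten_append]
            simp
        _ = _ := by rw [he]; simp
    obtain ⟨t, ht⟩ := hp
    rw [ht] at h2
    have := (suffix_of_common_suffix (by simp) h1 h2).length_le
    omega

theorem complexityC_zero : complexityC L γ 0 = 1 := by
  have : {w : List Bool | w.length = 0 ∧ InLangC L γ w} = {[]} := by
    ext w
    simp only [Set.mem_ofPred_eq, Set.mem_singleton_iff, List.length_eq_zero_iff]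
    exact ⟨And.left, fun h => ⟨h, 1, h ▸ List.nil_infix⟩⟩
  rw [complexityC, this, Set.ncard_singleton]

theorem complexityC_length_two (hL : ∀ n, 1 ≤ n → 2 ≤ L n) (hγ : ∀ n, 1 ≤ n → 2 ≤ γ n) :
    complexityC L γ ((Cseq L γ 2).length + 1) = (Cseq L γ 2).length + 2 * γ 1 + 2 := by
  have hb : (block L γ 1).length = 2 * γ 1 + 1 := by
    rw [length_block]; simp [Cseq]; ring
  have hr : (longRun L γ 1).length = 4 * γ 1 + 1 := by
    rw [length_longRun]; simp [Cseq]; ring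
  have hle : (longRun L γ 1).length ≤ (Cseq L γ 2).length := length_longRun_le hL le_rfl
  have h1 : ∀ i, i ≤ 2 * γ 1 + 2 → complexityC L γ i = i + 1 := by
    intro i
    induction i with
    | zero => exact fun _ => complexityC_zero
    | succ i ih =>
      intro hi
      rw [complexityC_succ_eq_add_one hL hγ le_rfl (by omega) (Or.inl (by omega))
        (show i ≤ (Cseq L γ 2).length by omega), ih (by omega)]
  have h2 : ∀ i, i ≤ 2 * γ 1 → complexityC L γ (2 * γ 1 + 2 + i) = 2 * γ 1 + 3 + 2 * i := by
    intro i
    induction i with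
    | zero => exact fun _ => h1 _ le_rfl
    | succ i ih =>
      intro hi
      rw [← Nat.add_assoc, complexityC_succ_of_le_longRun hL hγ le_rfl (by omega) (by omega)
        (by omega), ih (by omega)]
      omega
  have h3 : ∀ i, 4 * γ 1 + 2 + i ≤ (Cseq L γ 2).length + 1 →
      complexityC L γ (4 * γ 1 + 2 + i) = 6 * γ 1 + 3 + i := by
    intro i
    induction i with
    | zero =>
      intro _
      have := h2 (2 * γ 1) le_rfl
      rw [show 2 * γ 1 + 2 + 2 * γ 1 = 4 * γ 1 + 2 by ring] at this
      simp only [Nat.add_zero]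
      omega
    | succ i ih =>
      intro hi
      rw [← Nat.add_assoc, complexityC_succ_eq_add_one hL hγ le_rfl (by omega)
        (Or.inr (by omega)) (show _ ≤ (Cseq L γ 2).length by omega), ih (by omega)]
      omega
  obtain ⟨i, hi⟩ := Nat.exists_eq_add_of_le (show 4 * γ 1 + 2 ≤ (Cseq L γ 2).length + 1 by omega)
  have := h3 i (by omega)
  rw [hi, this]
  omega

theorem length_longPow_cast (hL : ∀ n, 1 ≤ n → 2 ≤ L n) {n : ℕ} (hn : 1 ≤ n) :
    ((longPow L γ n).length : ℝ) = (2 - 1 / (L n : ℝ)) * ((Cseq L γ (n + 1)).length : ℝ) := by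
  have h := hL n hn
  have h0 : (L n : ℝ) ≠ 0 := by
    have : L n ≠ 0 := by omega
    exact_mod_cast this
  rw [length_longPow, length_succ hn]
  push_cast [Nat.cast_sub (show 1 ≤ 2 * L n by omega)]
  field_simp

end

end Cseq

/-- The complexity of the subshift generated by `B_{n+1} = ((B_n 1)^{γ_n} B_n)^{L_n}`
satisfies `p(h_2 + 1) = h_2 (1 + 1/L_1) + 1`, and for `h_n < q ≤ h_{n+1}` the increment
`p(q+1) - p(q)` equals `2, 1, 2, 1` according to the four ranges
`h_n < q ≤ (2 - 1/L_{n-1}) h_n`, `(2 - 1/L_{n-1}) h_n < q ≤ (γ_n+1) h_n + γ_n`,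
`(γ_n+1) h_n + γ_n < q ≤ (2γ_n+1) h_n + 2γ_n`, `(2γ_n+1) h_n + 2γ_n < q ≤ h_{n+1}`. -/
theorem stmt16 (L γ : ℕ → ℕ) (hL : ∀ n, 1 ≤ n → 2 ≤ L n) (hγ : ∀ n, 1 ≤ n → 2 ≤ γ n) :
    (complexityC L γ ((Cseq L γ 2).length + 1) : ℝ) =
      ((Cseq L γ 2).length : ℝ) * (1 + 1 / (L 1 : ℝ)) + 1 ∧
    ∀ q : ℕ, (Cseq L γ 2).length < q →
      ∀ n : ℕ, (Cseq L γ n).length < q → q ≤ (Cseq L γ (n + 1)).length →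
        (((q : ℝ) ≤ (2 - 1 / (L (n - 1) : ℝ)) * ((Cseq L γ n).length : ℝ)) →
          complexityC L γ (q + 1) = complexityC L γ q + 2) ∧
        (((2 - 1 / (L (n - 1) : ℝ)) * ((Cseq L γ n).length : ℝ) < (q : ℝ) ∧
            q ≤ (γ n + 1) * (Cseq L γ n).length + γ n) →
          complexityC L γ (q + 1) = complexityC L γ q + 1) ∧
        (((γ n + 1) * (Cseq L γ n).length + γ n < q ∧
            q ≤ (2 * γ n + 1) * (Cseq L γ n).length + 2 * γ n) →
          complexityC L γ (q + 1) = complexityC L γ q + 2) ∧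
        (((2 * γ n + 1) * (Cseq L γ n).length + 2 * γ n < q ∧
            q ≤ (Cseq L γ (n + 1)).length) →
          complexityC L γ (q + 1) = complexityC L γ q + 1) := by
  refine ⟨?_, ?_⟩
  · have h := hL 1 le_rfl
    have h0 : (L 1 : ℝ) ≠ 0 := by
      have : L 1 ≠ 0 := by omega
      exact_mod_cast this
    have hlen : ((Cseq L γ 2).length : ℝ) = L 1 * (2 * γ 1 + 1) := by
      have : (Cseq L γ 2).length = L 1 * ((γ 1 + 1) * 1 + γ 1) := by
        rw [Cseq.length_succ le_rfl, Cseq.length_block]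
        rfl
      rw [this]
      push_cast
      ring
    rw [Cseq.complexityC_length_two hL hγ]
    push_cast
    rw [hlen]
    field_simp
    ring
  intro q hq n hlow hup
  have hn : 2 ≤ n := by
    rcases n with _ | _ | n
    · have : q ≤ 1 := hup
      have : 1 < q := hlow
      omega
    · exact absurd hup (by simpa using hq)
    · omega
  obtain ⟨m, rfl⟩ : ∃ m, n = m + 1 := ⟨n - 1, by omega⟩
  have hm : 1 ≤ m := by omega
  have hblock : 2 * (Cseq L γ (m + 1)).length ≤ (Cseq.block L γ (m + 1)).length := by
    rw [Cseq.length_block]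
    have := hγ (m + 1) (by omega)
    nlinarith
  have hpow := Cseq.length_longPow_le (L := L) (γ := γ) hm
  have hrun : (Cseq.block L γ (m + 1)).length ≤ (Cseq.longRun L γ (m + 1)).length :=
    (Cseq.block_suffix_longRun hγ (by omega)).length_le
  rw [Nat.add_sub_cancel, ← Cseq.length_longPow_cast hL hm, ← Cseq.length_block,
    ← Cseq.length_longRun]
  refine ⟨fun h => ?_, fun h => ?_, fun h => ?_, fun h => ?_⟩
  · exact Cseq.complexityC_succ_of_le_longPow hL hγ hm hlow (by exact_mod_cast h)
  · exact Cseq.complexityC_succ_eq_add_one hL hγ (by omega) (fun _ => by exact_mod_cast h.1)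
      (Or.inl h.2) hup
  · exact Cseq.complexityC_succ_of_le_longRun hL hγ (n := m + 1) (by omega)
      (fun _ => by simp only [Nat.add_sub_cancel]; omega) h.1 h.2
  · exact Cseq.complexityC_succ_eq_add_one hL hγ (n := m + 1) (by omega)
      (fun _ => by simp only [Nat.add_sub_cancel]; omega) (Or.inr h.1) hup
end
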